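/- arXiv:2312.05997 — 3 statements merged into one kernel-verified Lean document; each statement's English description precedes it below -/
import Mathlib

section
/- Every term in a complete exceptional sequence over a finite-dimensional hereditary algebra is relatively projective or relatively injective (or both). That is, if (E₁,…,Eₙ) is a complete exceptional sequence over Λ, then for each k, either Eₖ is a projective object of the wide subcategory 𝒜ₖ = (E_{k+1}⊕⋯⊕Eₙ)^⊥, or Eₖ is an injective object of the wide subcategory ℬₖ = ^⊥(E₁⊕⋯⊕E_{k−1}). -/
open CategoryTheory

universe u

variable {A : Type u} [Ring A]

namespace ExcSeq

/-- `Hom(X, Y) = 0`. -/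
def homZero (X Y : ModuleCat.{u} A) : Prop := ∀ f : X ⟶ Y, f = 0

/-- `Ext¹(X, Y) = 0`: every short exact sequence `0 → Y → E → X → 0` splits. -/
def extZero (X Y : ModuleCat.{u} A) : Prop :=
  ∀ (E : ModuleCat.{u} A) (i : Y ⟶ E) (p : E ⟶ X) (w : i ≫ p = 0),
    (ShortComplex.mk i p w).ShortExact → ∃ s : X ⟶ E, s ≫ p = 𝟙 X

/-- `Y` belongs to the right perpendicular category `X^⊥`. -/
def rperp (X Y : ModuleCat.{u} A) : Prop := homZero X Y ∧ extZero X Y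

/-- `Y` belongs to the left perpendicular category `^⊥X`. -/
def lperp (X Y : ModuleCat.{u} A) : Prop := homZero Y X ∧ extZero Y X

/-- An exceptional module: finitely generated, rigid, with division algebra endomorphism
ring (in particular nonzero and indecomposable). -/
def ExceptionalMod (X : ModuleCat.{u} A) : Prop :=
  Module.Finite A X ∧ extZero X X ∧ Nontrivial X ∧ ∀ f : X ⟶ X, f ≠ 0 → IsIso f

/-- An exceptional sequence `(E 0, …, E (n-1))`. -/
def IsExcSeq {n : ℕ} (E : Fin n → ModuleCat.{u} A) : Prop :=
  (∀ i, ExceptionalMod (E i)) ∧ ∀ i j : Fin n, i < j → rperp (E j) (E i)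

/-- A complete exceptional sequence: an exceptional sequence of maximal length. -/
def CompleteES {n : ℕ} (E : Fin n → ModuleCat.{u} A) : Prop :=
  IsExcSeq E ∧ ∀ (m : ℕ) (F : Fin m → ModuleCat.{u} A), IsExcSeq F → m ≤ n

/-- The wide subcategory `𝒜ₖ = (E_{k+1} ⊕ ⋯ ⊕ Eₙ)^⊥`. -/
def Aperp {n : ℕ} (E : Fin n → ModuleCat.{u} A) (k : Fin n) (X : ModuleCat.{u} A) : Prop :=
  ∀ j : Fin n, k < j → rperp (E j) X

/-- The wide subcategory `ℬₖ = ^⊥(E₁ ⊕ ⋯ ⊕ E_{k-1})`. -/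
def Bperp {n : ℕ} (E : Fin n → ModuleCat.{u} A) (k : Fin n) (X : ModuleCat.{u} A) : Prop :=
  ∀ j : Fin n, j < k → lperp (E j) X

/-- `X` is a projective object of the subcategory (given by the predicate) `C`. -/
def ProjIn (C : ModuleCat.{u} A → Prop) (X : ModuleCat.{u} A) : Prop :=
  C X ∧ ∀ (Y Z : ModuleCat.{u} A), C Y → C Z → ∀ p : Y ⟶ Z, Epi p →
    ∀ f : X ⟶ Z, ∃ g : X ⟶ Y, g ≫ p = f

/-- `X` is an injective object of the subcategory (given by the predicate) `C`. -/
def InjIn (C : ModuleCat.{u} A → Prop) (X : ModuleCat.{u} A) : Prop :=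
  C X ∧ ∀ (Y Z : ModuleCat.{u} A), C Y → C Z → ∀ i : Y ⟶ Z, Mono i →
    ∀ f : Y ⟶ X, ∃ g : Z ⟶ X, i ≫ g = f

/-- `E k` is relatively projective in the exceptional sequence `E`. -/
def RelProj {n : ℕ} (E : Fin n → ModuleCat.{u} A) (k : Fin n) : Prop :=
  ProjIn (Aperp E k) (E k)

/-- `E k` is relatively injective in the exceptional sequence `E`. -/
def RelInj {n : ℕ} (E : Fin n → ModuleCat.{u} A) (k : Fin n) : Prop :=
  InjIn (Bperp E k) (E k)

/-- `Λ` is hereditary: every submodule of a projective module is projective. -/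
def Hereditary (A : Type u) [Ring A] : Prop :=
  ∀ (P : ModuleCat.{u} A), Projective P →
    ∀ S : Submodule A P, Projective (ModuleCat.of A S)

/-- The simple module `S` is in the support of `M`, i.e. `S` is (isomorphic to) a
composition factor (subquotient) of `M`. -/
def InSupport (S M : ModuleCat.{u} A) : Prop :=
  ∃ (N₁ N₂ : Submodule A M), N₁ ≤ N₂ ∧
    Nonempty ((ModuleCat.of A (N₂ ⧸ (Submodule.comap N₂.subtype N₁))) ≅ S)


section helpers

open Abelian Limits

abbrev X1 (X Y : ModuleCat.{u} A) := Ext.{u} X Y 1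

def E0 (X Y : ModuleCat.{u} A) : Prop := ∀ e : X1 X Y, e = 0

lemma realize {X Y : ModuleCat.{u} A} (e : X1 X Y) :
    ∃ (Q : ModuleCat.{u} A) (i : Y ⟶ Q) (p : Q ⟶ X) (w : i ≫ p = 0)
      (h : (ShortComplex.mk i p w).ShortExact), h.extClass = e := by
  let S : ShortComplex (ModuleCat.{u} A) := ShortComplex.mk (kernel.ι (Projective.π X)) (Projective.π X) (by simp)
  have hS : S.ShortExact :=
    { exact := ShortComplex.exact_of_f_is_kernel _ (kernelIsKernel _) 
      mono_f := by dsimp [S]; infer_instance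
      epi_g := by dsimp [S]; infer_instance }
  obtain ⟨x, hx⟩ := Ext.contravariant_sequence_exact₃ hS Y e
    (Ext.eq_zero_of_projective _) (n₀ := 0) rfl
  obtain ⟨g, rfl⟩ := Ext.addEquiv₀.symm.surjective x
  have := hS.mono_f
  have := hS.epi_g
  obtain ⟨p, hp1, w⟩ : ∃ p : pushout S.f g ⟶ X, pushout.inl S.f g ≫ p = S.g ∧ 
      pushout.inr S.f g ≫ p = 0 := 
    ⟨pushout.desc S.g 0 (by simp), pushout.inl_desc _ _ _, pushout.inr_desc _ _ _⟩
  have hp : Epi p := by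
    have : Epi (pushout.inl S.f g ≫ p) := by rw [hp1]; infer_instance
    exact epi_of_epi (pushout.inl S.f g) p
  have h : (ShortComplex.mk _ p w).ShortExact := 
    { exact := by
        apply ShortComplex.exact_of_g_is_cokernel
        refine CokernelCofork.IsColimit.ofπ' _ _ (fun {Z} k hk => ⟨hS.exact.desc (pushout.inl S.f g ≫ k) (by rw [pushout.condition_assoc]; dsimp at hk; simp [hk]), ?_⟩)
        dsimp at hk ⊢
        apply pushout.hom_ext
        · rw [← Category.assoc, hp1]
          exact hS.exact.g_desc _ _
        · rw [← Category.assoc, w]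
          exact zero_comp.trans hk.symm
      mono_f := by dsimp; infer_instance
      epi_g := hp }
  refine ⟨_, _, p, w, h, ?_⟩
  let φ : S ⟶ ShortComplex.mk _ p w := 
    { τ₁ := g, τ₂ := pushout.inl _ _, τ₃ := 𝟙 X
      comm₁₂ := by dsimp; exact pushout.condition.symm
      comm₂₃ := by refine hp1.trans (Category.comp_id _).symm }
  have := ShortComplex.ShortExact.extClass_naturality hS h φ
  rw [← hx]
  refine Eq.trans ?_ this.symm
  exact (Ext.mk₀_id_comp _).symm

lemma lift_of_E0 {S : ShortComplex (ModuleCat.{u} A)} (h : S.ShortExact) {X : ModuleCat.{u} A}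
    (hX : E0 X S.X₁) (f : X ⟶ S.X₃) : ∃ g : X ⟶ S.X₂, g ≫ S.g = f := by
  obtain ⟨x, hx⟩ := Ext.covariant_sequence_exact₃ X h (Ext.mk₀ f) rfl (hX _)
  obtain ⟨g, rfl⟩ := Ext.addEquiv₀.symm.surjective x
  refine ⟨g, Ext.mk₀_bijective _ _ |>.1 ?_⟩
  simpa using hx

lemma desc_of_E0 {S : ShortComplex (ModuleCat.{u} A)} (h : S.ShortExact) {Y : ModuleCat.{u} A}
    (hX : E0 S.X₃ Y) (f : S.X₁ ⟶ Y) : ∃ g : S.X₂ ⟶ Y, S.f ≫ g = f := by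
  obtain ⟨x, hx⟩ := Ext.contravariant_sequence_exact₁ h Y (Ext.mk₀ f) rfl (hX _)
  obtain ⟨g, rfl⟩ := Ext.addEquiv₀.symm.surjective x
  refine ⟨g, Ext.mk₀_bijective _ _ |>.1 ?_⟩
  simpa using hx

lemma extZero_iff (X Y : ModuleCat.{u} A) : extZero X Y ↔ E0 X Y := by
  constructor
  · intro h e
    obtain ⟨Q, i, p, w, hs, rfl⟩ := realize e
    obtain ⟨s, hs'⟩ := h Q i p w hs
    have h2 : (Ext.mk₀ (s ≫ p)).comp hs.extClass (zero_add 1) = 0 := by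
      rw [← Ext.mk₀_comp_mk₀_assoc]
      have := hs.comp_extClass
      dsimp at this
      rw [this]; simp
    rw [hs'] at h2
    simpa using h2
  · intro h Q i p w hs
    exact lift_of_E0 hs h (𝟙 X)

section les
variable {S : ShortComplex (ModuleCat.{u} A)} (h : S.ShortExact)
include h

lemma E0_cov2 {Y : ModuleCat.{u} A} (h1 : E0 Y S.X₁) (h3 : E0 Y S.X₃) : E0 Y S.X₂ := by
  intro e
  obtain ⟨x, rfl⟩ := Ext.covariant_sequence_exact₂ Y h e (h3 _)
  rw [h1 x]; simp

lemma E0_cov1 {Y : ModuleCat.{u} A} (h1 : homZero Y S.X₃) (h3 : E0 Y S.X₂) : E0 Y S.X₁ := by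
  intro e
  obtain ⟨x, rfl⟩ := Ext.covariant_sequence_exact₁ Y h e (h3 _) (n₀ := 0) rfl
  obtain ⟨g, rfl⟩ := Ext.addEquiv₀.symm.surjective x
  rw [h1 g]; simp

lemma hz_cov3 {Y : ModuleCat.{u} A} (h1 : homZero Y S.X₂) (h3 : E0 Y S.X₁) :
    homZero Y S.X₃ := by
  intro f
  obtain ⟨g, rfl⟩ := lift_of_E0 h h3 f
  rw [h1 g]; simp

lemma hz_cov1 {Y : ModuleCat.{u} A} (h1 : homZero Y S.X₂) : homZero Y S.X₁ := by
  intro f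
  have := h.mono_f
  rw [← cancel_mono S.f, h1 (f ≫ S.f)]; simp

lemma hz_cov2 {Y : ModuleCat.{u} A} (h1 : homZero Y S.X₁) (h3 : homZero Y S.X₃) :
    homZero Y S.X₂ := by
  intro f
  have := h.mono_f
  rw [← h.exact.lift_f f (h3 _), h1 (h.exact.lift f _)]; simp

lemma E0_con2 {Y : ModuleCat.{u} A} (h1 : E0 S.X₁ Y) (h3 : E0 S.X₃ Y) : E0 S.X₂ Y := by
  intro e
  obtain ⟨x, rfl⟩ := Ext.contravariant_sequence_exact₂ h Y e (h1 _)
  rw [h3 x]; simp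

lemma E0_con3 {Y : ModuleCat.{u} A} (h1 : homZero S.X₁ Y) (h3 : E0 S.X₂ Y) : E0 S.X₃ Y := by
  intro e
  obtain ⟨x, rfl⟩ := Ext.contravariant_sequence_exact₃ h Y e (h3 _) (n₀ := 0) rfl
  obtain ⟨g, rfl⟩ := Ext.addEquiv₀.symm.surjective x
  rw [h1 g]; simp

lemma hz_con3 {Y : ModuleCat.{u} A} (h1 : homZero S.X₂ Y) : homZero S.X₃ Y := by
  intro f
  have := h.epi_g
  rw [← cancel_epi S.g, h1 (S.g ≫ f)]; simp

end les

lemma ext2 (hA : Hereditary A) {X Y : ModuleCat.{u} A} (e : Ext.{u} X Y 2) : e = 0 := by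
  let p : Projective.over X ⟶ X := Projective.π X
  let S : ShortComplex (ModuleCat.{u} A) := ShortComplex.mk (ModuleCat.ofHom (LinearMap.ker p.hom).subtype) p
    (by ext x; exact x.2)
  have hS : S.ShortExact :=
    { exact := by
        rw [ShortComplex.moduleCat_exact_iff]
        intro x hx
        exact ⟨⟨x, hx⟩, rfl⟩
      mono_f := by rw [ModuleCat.mono_iff_injective]; exact Subtype.val_injective
      epi_g := by dsimp [S, p]; infer_instance }
  have hp : Projective S.X₁ := hA _ inferInstance _
  have hp : Projective S.X₂ := by dsimp [S]; infer_instance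
  obtain ⟨x, rfl⟩ := Ext.contravariant_sequence_exact₃ hS Y e
    (Ext.eq_zero_of_projective _) (n₀ := 1) rfl
  rw [Ext.eq_zero_of_projective x]; simp

lemma E0_cov3 (hA : Hereditary A) {S : ShortComplex (ModuleCat.{u} A)} (h : S.ShortExact)
    {Y : ModuleCat.{u} A} (h2 : E0 Y S.X₂) : E0 Y S.X₃ := by
  intro e
  obtain ⟨x, rfl⟩ := Ext.covariant_sequence_exact₃ Y h e (n₁ := 2) rfl (ext2 hA _)
  rw [h2 x]; simp

lemma E0_con1 (hA : Hereditary A) {S : ShortComplex (ModuleCat.{u} A)} (h : S.ShortExact)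
    {Y : ModuleCat.{u} A} (h2 : E0 S.X₂ Y) : E0 S.X₁ Y := by
  intro e
  obtain ⟨x, rfl⟩ := Ext.contravariant_sequence_exact₁ h Y e (n₁ := 2) rfl (ext2 hA _)
  rw [h2 x]; simp

lemma mkSES {X Y Z : ModuleCat.{u} A} (i : X ⟶ Y) (p : Y ⟶ Z) (w : i ≫ p = 0)
    (hi : Function.Injective i) (hp : Function.Surjective p)
    (he : ∀ y, p y = 0 → ∃ x, i x = y) : (ShortComplex.mk i p w).ShortExact :=
  { exact := by
      rw [ShortComplex.moduleCat_exact_iff]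
      exact he
    mono_f := by rw [ModuleCat.mono_iff_injective]; exact hi
    epi_g := by rw [ModuleCat.epi_iff_surjective]; exact hp }

abbrev sm (X : ModuleCat.{u} A) (N : Submodule A X) : ModuleCat.{u} A := ModuleCat.of A N
abbrev qm (X : ModuleCat.{u} A) (N : Submodule A X) : ModuleCat.{u} A := ModuleCat.of A (X ⧸ N)

abbrev subSES (X : ModuleCat.{u} A) (N : Submodule A X) : ShortComplex (ModuleCat.{u} A) :=
  ShortComplex.mk (X₁ := sm X N) (X₂ := X) (X₃ := qm X N) (ModuleCat.ofHom N.subtype) (ModuleCat.ofHom N.mkQ)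
    (by ext x; simp)

lemma subSES_exact (X : ModuleCat.{u} A) (N : Submodule A X) : (subSES X N).ShortExact := by
  apply mkSES
  · exact Subtype.val_injective
  · exact N.mkQ_surjective
  · intro y hy
    exact ⟨⟨y, (Submodule.Quotient.mk_eq_zero N).1 hy⟩, rfl⟩

abbrev kerSES {X Y : ModuleCat.{u} A} (f : X ⟶ Y) : ShortComplex (ModuleCat.{u} A) :=
  ShortComplex.mk (X₁ := sm X (LinearMap.ker f.hom)) (X₂ := X) (X₃ := Y)
    (ModuleCat.ofHom (LinearMap.ker f.hom).subtype) f (by ext x; exact x.2)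

lemma kerSES_exact {X Y : ModuleCat.{u} A} (f : X ⟶ Y) (hf : Function.Surjective f) :
    (kerSES f).ShortExact := by
  apply mkSES
  · exact Subtype.val_injective
  · exact hf
  · intro y hy
    exact ⟨⟨y, hy⟩, rfl⟩

lemma cls_retr {S : ShortComplex (ModuleCat.{u} A)} (h : S.ShortExact) (r : S.X₂ ⟶ S.X₁)
    (hr : S.f ≫ r = 𝟙 _) : (h.extClass : X1 S.X₃ S.X₁) = 0 := by
  have : (h.extClass : X1 S.X₃ S.X₁).comp (Ext.mk₀ (S.f ≫ r)) (add_zero 1) = 0 := by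
    rw [← Ext.mk₀_comp_mk₀]
    exact h.extClass_comp_assoc _
  rw [hr] at this
  simpa using this

lemma cls_sec {S : ShortComplex (ModuleCat.{u} A)} (h : S.ShortExact) (r : S.X₃ ⟶ S.X₂)
    (hr : r ≫ S.g = 𝟙 _) : (h.extClass : X1 S.X₃ S.X₁) = 0 := by
  have : (Ext.mk₀ (r ≫ S.g)).comp (h.extClass : X1 S.X₃ S.X₁) (zero_add 1) = 0 := by
    rw [← Ext.mk₀_comp_mk₀_assoc, h.comp_extClass]; simp
  rw [hr] at this
  simpa using this

noncomputable abbrev pw (V : Type u) (E : ModuleCat.{u} A) : ModuleCat.{u} A := ModuleCat.of A (V →₀ E)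
noncomputable abbrev iv {V : Type u} (E : ModuleCat.{u} A) (v : V) : E ⟶ pw V E :=
  ModuleCat.ofHom (Finsupp.lsingle v)
noncomputable abbrev pv {V : Type u} (E : ModuleCat.{u} A) (v : V) : pw V E ⟶ E :=
  ModuleCat.ofHom (Finsupp.lapply v)

lemma E0_pi {Y E : ModuleCat.{u} A} (V : Type u) (h : E0 Y E) :
    E0 Y (ModuleCat.of A (V → E)) := by
  intro e
  obtain ⟨Q, i, p, w, hs, rfl⟩ := realize e
  have (v : V) : ∃ g : Q ⟶ E, i ≫ g = ModuleCat.ofHom (LinearMap.proj v) :=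
    desc_of_E0 hs h _
  choose g hg using this
  refine cls_retr hs (ModuleCat.ofHom (LinearMap.pi fun v => (g v).hom)) ?_
  ext x v
  exact congr($(hg v).hom x)

lemma E0_retract {Y E F : ModuleCat.{u} A} (i : E ⟶ F) (r : F ⟶ E) (hr : i ≫ r = 𝟙 _)
    (h : E0 Y F) : E0 Y E := by
  intro e
  have := h (e.comp (Ext.mk₀ i) (add_zero 1))
  have h2 : (e.comp (Ext.mk₀ i) (add_zero 1)).comp (Ext.mk₀ r) (add_zero 1) = 0 := by
    rw [this]; simp
  rw [Ext.comp_assoc_of_third_deg_zero, Ext.mk₀_comp_mk₀, hr] at h2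
  simpa using h2

lemma hz_finsupp_right {Y E : ModuleCat.{u} A} (V : Type u) (h : homZero Y E) :
    homZero Y (pw V E) := by
  intro f
  apply ModuleCat.hom_ext
  refine LinearMap.ext fun x => ?_
  refine Finsupp.ext (M := E) fun v => ?_
  exact congr($(h (f ≫ pv E v)).hom x)

lemma hz_finsupp_left {Y E : ModuleCat.{u} A} (V : Type u) (h : homZero E Y) :
    homZero (pw V E) Y := by
  intro f
  apply ModuleCat.hom_ext
  refine Finsupp.lhom_ext' fun v => ?_
  ext x
  exact congr($(h (iv E v ≫ f)).hom x)

lemma E0_finsupp_left {Y E : ModuleCat.{u} A} (V : Type u) (h : E0 E Y) :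
    E0 (pw V E) Y := by
  intro e
  obtain ⟨Q, i, p, w, hs, rfl⟩ := realize e
  have (v : V) : ∃ g : E ⟶ Q, g ≫ p = iv E v :=
    lift_of_E0 hs h _
  choose g hg using this
  refine cls_sec hs (ModuleCat.ofHom (Finsupp.lsum ℕ fun v => (g v).hom)) ?_
  apply ModuleCat.hom_ext
  refine Finsupp.lhom_ext' fun v => ?_
  ext x : 1
  have := congr($(hg v).hom x)
  simpa using this

section fd

lemma retr_exists (K : Type u) [Field K] [Algebra K A] [FiniteDimensional K A] (E : ModuleCat.{u} A) (hE : Module.Finite A E) (V : Type u) :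
    ∃ r : (V → E) →ₗ[A] (V →₀ E), ∀ x : V →₀ E, r (fun v => x v) = x := by
  let _ : Module K E := Module.compHom E (algebraMap K A)
  have : IsScalarTower K A E := ⟨fun c a x => by
    rw [Algebra.smul_def, mul_smul]; rfl⟩
  have : Module.Finite K E := Module.Finite.trans A E
  let b := Module.finBasis K E
  obtain ⟨r, hr⟩ := LinearMap.exists_leftInverse_of_injective
    (Finsupp.lcoeFun : (V →₀ K) →ₗ[K] (V → K))
    (LinearMap.ker_eq_bot.2 DFunLike.coe_injective)
  replace hr : ∀ y : V →₀ K, r (fun v => y v) = y := fun y => congr($hr y)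
  let ρ : (V → E) → (V →₀ E) := fun x =>
    ∑ i, (r (fun v => b.repr (x v) i)).mapRange (fun c => c • b i) (by simp)
  have key (φ : E →ₗ[K] K) (x : V → E) (v : V) : φ (ρ x v) = r (fun w => φ (x w)) v := by
    have h1 : (fun w => φ (x w)) = ∑ i, φ (b i) • (fun w => b.repr (x w) i) := by
      funext w
      conv_lhs => rw [← b.sum_repr (x w), map_sum]
      simp [mul_comm]
    rw [h1, map_sum]
    simp [ρ, Finsupp.finsetSum_apply, mul_comm]
  have ext' {x y : E} (h : ∀ φ : E →ₗ[K] K, φ x = φ y) : x = y := by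
    apply b.repr.injective
    ext i
    exact h (b.coord i)
  refine ⟨{ toFun := ρ, map_add' := ?_, map_smul' := ?_ }, ?_⟩
  · intro x y
    refine Finsupp.ext fun v => ext' fun φ => ?_
    rw [Finsupp.add_apply, map_add, key, key, key, ← Finsupp.add_apply, ← map_add]
    congr 2; funext w; simp
  · intro a x
    refine Finsupp.ext fun v => ext' fun φ => ?_
    have : SMulCommClass A K E := ⟨fun a c x => by
      change a • (algebraMap K A c • x) = algebraMap K A c • (a • x)
      rw [← mul_smul, ← mul_smul, Algebra.commutes]⟩
    let ψ : E →ₗ[K] K := φ ∘ₗ (Module.toModuleEnd K (S := A) E a)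
    have h2 : φ ((a • ρ x) v) = ψ (ρ x v) := rfl
    simp only [RingHom.id_apply]
    rw [h2, key, key]
    rfl
  · intro x
    refine Finsupp.ext fun v => ext' fun φ => ?_
    change φ (ρ _ v) = _
    rw [key]
    have := hr (x.mapRange φ (map_zero φ))
    exact congr($this v)

lemma E0_finsupp_right (K : Type u) [Field K] [Algebra K A] [FiniteDimensional K A] {Y E : ModuleCat.{u} A} (hE : Module.Finite A E) (V : Type u)
    (h : E0 Y E) : E0 Y (pw V E) := by
  obtain ⟨r, hr⟩ := retr_exists K E hE V
  refine E0_retract (ModuleCat.ofHom Finsupp.lcoeFun) (ModuleCat.ofHom r) ?_ (E0_pi V h)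
  apply ModuleCat.hom_ext
  exact LinearMap.ext hr
end fd

lemma univ_ext {V : Type u} {E X : ModuleCat.{u} A} (e : V → X1 E X) :
    ∃ (Q : ModuleCat.{u} A) (i : X ⟶ Q) (p : Q ⟶ pw V E) (w : i ≫ p = 0)
      (h : (ShortComplex.mk i p w).ShortExact),
      ∀ v, (Ext.mk₀ (iv E v)).comp (h.extClass : X1 _ _) (zero_add 1) = e v := by
  have hπ : Function.Surjective (Projective.π E) := by
    rw [← ModuleCat.epi_iff_surjective]; infer_instance
  have hS := kerSES_exact (Projective.π E) hπ
  have (v : V) : ∃ g : (kerSES (Projective.π E)).X₁ ⟶ X,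
      (hS.extClass : X1 _ _).comp (Ext.mk₀ g) (add_zero 1) = e v := by
    obtain ⟨x, hx⟩ := Ext.contravariant_sequence_exact₃ hS X (e v)
      (Ext.eq_zero_of_projective _) (n₀ := 0) rfl
    obtain ⟨g, rfl⟩ := Ext.addEquiv₀.symm.surjective x
    exact ⟨g, hx⟩
  choose g hg using this
  let R := (kerSES (Projective.π E)).X₁
  let T : ShortComplex (ModuleCat.{u} A) :=
    ShortComplex.mk (X₁ := pw V R) (X₂ := pw V (Projective.over E)) (X₃ := pw V E)
      (ModuleCat.ofHom (Finsupp.mapRange.linearMap (kerSES (Projective.π E)).f.hom))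
      (ModuleCat.ofHom (Finsupp.mapRange.linearMap (Projective.π E).hom)) (by
        apply ModuleCat.hom_ext
        refine LinearMap.ext fun x => ?_
        refine Finsupp.ext (M := E) fun v => ?_
        exact (x v).2)
  have hT : T.ShortExact := by
    apply mkSES
    · exact Finsupp.mapRange_injective _ (map_zero _) Subtype.val_injective
    · exact Finsupp.mapRange_surjective _ (map_zero _) hπ
    · intro y hy
      have hy' (v : V) : Projective.π E (y v) = 0 := congr($hy v)
      refine ⟨Finsupp.onFinset y.support (fun v => ⟨y v, hy' v⟩) ?_, ?_⟩
      · intro v hv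
        rw [Finsupp.mem_support_iff]
        intro h
        apply hv
        exact Subtype.ext h
      · refine Finsupp.ext fun v => ?_
        rfl
  obtain ⟨Q, i, p, w, h, hh⟩ := realize ((hT.extClass : X1 _ _).comp
    (Ext.mk₀ (ModuleCat.ofHom (Finsupp.lsum ℕ fun v => (g v).hom) : pw V R ⟶ X)) (add_zero 1))
  refine ⟨Q, i, p, w, h, fun v => ?_⟩
  let φ : kerSES (Projective.π E) ⟶ T :=
    { τ₁ := iv R v, τ₂ := iv _ v, τ₃ := iv E v
      comm₁₂ := by
        ext x : 2
        exact (Finsupp.mapRange_single (hf := map_zero _))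
      comm₂₃ := by
        ext x : 2
        exact (Finsupp.mapRange_single (hf := map_zero _)) }
  have nat := ShortComplex.ShortExact.extClass_naturality hS hT φ
  change _ = (Ext.mk₀ (iv E v)).comp (hT.extClass : X1 _ _) _ at nat
  refine (congrArg (fun z => (Ext.mk₀ (iv E v)).comp z (zero_add 1)) hh).trans ?_
  dsimp only
  rw [← hg v]
  refine (Ext.comp_assoc_of_third_deg_zero _ _ _ _).symm.trans ?_
  rw [← nat]
  refine (Ext.comp_assoc_of_third_deg_zero _ _ _ _).trans ?_
  congr 1
  refine (Ext.mk₀_comp_mk₀ _ _).trans ?_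
  congr 1
  ext x : 2
  exact Finsupp.lsum_single (S := ℕ) (fun v => (g v).hom) v x

noncomputable abbrev tm (E X : ModuleCat.{u} A) : pw (E ⟶ X) E ⟶ X :=
  ModuleCat.ofHom (Finsupp.lsum ℕ fun f : E ⟶ X => f.hom)

def rg {X Y : ModuleCat.{u} A} (f : X ⟶ Y) : Submodule A Y := LinearMap.range f.hom

def rr {X Y : ModuleCat.{u} A} (f : X ⟶ Y) : X ⟶ sm Y (rg f) :=
  ModuleCat.ofHom (LinearMap.rangeRestrict f.hom)

lemma rr_surj {X Y : ModuleCat.{u} A} (f : X ⟶ Y) : Function.Surjective (rr f) :=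
  LinearMap.surjective_rangeRestrict f.hom

noncomputable abbrev tr (E X : ModuleCat.{u} A) : Submodule A X := rg (tm E X)

def PP (E X : ModuleCat.{u} A) : Prop := homZero E X ∧ E0 E X

lemma rperp_iff (E X : ModuleCat.{u} A) : rperp E X ↔ PP E X :=
  and_congr Iff.rfl (extZero_iff _ _)

lemma lperp_iff (E X : ModuleCat.{u} A) : lperp E X ↔ PP X E :=
  and_congr Iff.rfl (extZero_iff _ _)

lemma mem_tr {E X : ModuleCat.{u} A} (f : E ⟶ X) (x : E) : f x ∈ tr E X :=
  ⟨Finsupp.single f x, Finsupp.lsum_single (S := ℕ) (fun f : E ⟶ X => f.hom) f x⟩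

lemma E0_rg (hA : Hereditary A) {M X Y : ModuleCat.{u} A} (f : X ⟶ Y) (h : E0 M X) :
    E0 M (sm Y (rg f)) :=
  E0_cov3 hA (kerSES_exact _ (rr_surj f)) h

lemma PP_rg (hA : Hereditary A) {M X Y : ModuleCat.{u} A} (f : X ⟶ Y) (h : PP M X)
    (h' : PP M Y) : PP M (sm Y (rg f)) :=
  ⟨hz_cov1 (subSES_exact Y (rg f)) h'.1, E0_rg hA f h.2⟩

lemma PP_q (hA : Hereditary A) {M X Y : ModuleCat.{u} A} (f : X ⟶ Y) (h : PP M X)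
    (h' : PP M Y) : PP M (qm Y (rg f)) :=
  ⟨hz_cov3 (subSES_exact Y (rg f)) h'.1 (PP_rg hA f h h').2, E0_cov3 hA (subSES_exact Y (rg f)) h'.2⟩

lemma PP_2 {M : ModuleCat.{u} A} {S : ShortComplex (ModuleCat.{u} A)} (h : S.ShortExact)
    (h1 : PP M S.X₁) (h3 : PP M S.X₃) : PP M S.X₂ :=
  ⟨hz_cov2 h h1.1 h3.1, E0_cov2 h h1.2 h3.2⟩

lemma hz_rg {C X Y : ModuleCat.{u} A} (f : X ⟶ Y) (h : homZero X C) : homZero (sm Y (rg f)) C :=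
  hz_con3 (kerSES_exact _ (rr_surj f)) h

section fd2

lemma PP_pw (K : Type u) [Field K] [Algebra K A] [FiniteDimensional K A]
    {M E : ModuleCat.{u} A} (hE : Module.Finite A E) (V : Type u)
    (h : PP M E) : PP M (pw V E) :=
  ⟨hz_finsupp_right V h.1, E0_finsupp_right K hE V h.2⟩

lemma PP_coker (K : Type u) [Field K] [Algebra K A] [FiniteDimensional K A] (hA : Hereditary A)
    {E X : ModuleCat.{u} A} (hE : Module.Finite A E) (hEE : E0 E E) (h : E0 E X) :
    PP E (qm X (tr E X)) := by
  have hs := subSES_exact X (tr E X)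
  refine ⟨fun f => ?_, E0_cov3 hA hs h⟩
  obtain ⟨g, rfl⟩ := lift_of_E0 hs (E0_rg hA (tm E X) (E0_finsupp_right K hE _ hEE)) f
  ext x
  exact (Submodule.Quotient.mk_eq_zero _).2 (mem_tr g x)

lemma E0_refl (K : Type u) [Field K] [Algebra K A] [FiniteDimensional K A]
    {E X Q : ModuleCat.{u} A} {V : Type u} {i : X ⟶ Q} {p : Q ⟶ pw V E} {w : i ≫ p = 0}
    (h : (ShortComplex.mk i p w).ShortExact)
    (hE : Module.Finite A E) (hEE : E0 E E)
    (hi : ∀ e : X1 E X, e.comp (Ext.mk₀ i) (add_zero 1) = 0) : E0 E Q := by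
  intro e
  obtain ⟨x, hx⟩ := Ext.covariant_sequence_exact₂ E h e (E0_finsupp_right K hE V hEE _)
  rw [← hx]
  exact hi x

lemma comp_i {E X Q : ModuleCat.{u} A} {V : Type u} {i : X ⟶ Q} {p : Q ⟶ pw V E}
    {w : i ≫ p = 0} (h : (ShortComplex.mk i p w).ShortExact) (v : V) (e : X1 E X)
    (he : (Ext.mk₀ (iv E v)).comp (h.extClass : X1 _ _) (zero_add 1) = e) :
    e.comp (Ext.mk₀ i) (add_zero 1) = 0 := by
  rw [← he, Ext.comp_assoc_of_third_deg_zero]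
  have := h.extClass_comp
  dsimp only at this
  rw [this]; simp

lemma reflect (K : Type u) [Field K] [Algebra K A] [FiniteDimensional K A]
    {E : ModuleCat.{u} A} (X : ModuleCat.{u} A) (hE : Module.Finite A E) (hEE : E0 E E) :
    ∃ (V : Type u) (Q : ModuleCat.{u} A) (i : X ⟶ Q) (p : Q ⟶ pw V E) (w : i ≫ p = 0),
      (ShortComplex.mk i p w).ShortExact ∧ E0 E Q := by
  obtain ⟨Q, i, p, w, h, hh⟩ := univ_ext (fun e : X1 E X => e)
  exact ⟨_, Q, i, p, w, h, E0_refl K h hE hEE fun e => comp_i h e e (hh e)⟩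

open scoped ModuleCat in
lemma fin_hom (K : Type u) [Field K] [Algebra K A] [FiniteDimensional K A]
    (R X : ModuleCat.{u} A) (hR : Module.Finite A R) (hX : Module.Finite A X) :
    Module.Finite K (R ⟶ X) := by
  have : Module.Finite K R := Module.Finite.trans A R
  have : Module.Finite K X := Module.Finite.trans A X
  let f : (R ⟶ X) →ₗ[K] (R →ₗ[K] X) :=
    { toFun := fun g => g.hom.restrictScalars K
      map_add' := fun _ _ => rfl
      map_smul' := fun _ _ => rfl }
  refine Module.Finite.of_injective f ?_
  intro a b hab
  ext x
  exact congr($hab x)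

lemma fin_ext (K : Type u) [Field K] [Algebra K A] [FiniteDimensional K A]
    (E X : ModuleCat.{u} A) (hE : Module.Finite A E) (hX : Module.Finite A X) :
    Module.Finite K (X1 E X) := by
  obtain ⟨n, f, hf⟩ := Module.Finite.exists_fin' A E
  have hS := kerSES_exact (X := ModuleCat.of A (Fin n → A)) (ModuleCat.ofHom f) hf
  have : IsNoetherianRing A := isNoetherian_of_isNoetherianRing_of_finite K A |> fun h => 
    isNoetherian_of_tower K h
  set R := (kerSES (X := ModuleCat.of A (Fin n → A)) (ModuleCat.ofHom f)).X₁ with hR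
  have : Module.Finite A R := by
    change Module.Finite A (LinearMap.ker f); infer_instance
  have := fin_hom K R X this hX
  have : Projective (ModuleCat.of A (Fin n → A)) := by
    rw [← IsProjective.iff_projective]; infer_instance
  let φ : (R ⟶ X) →ₗ[K] X1 E X :=
    { toFun := fun g => (hS.extClass : X1 _ _).comp (Ext.mk₀ g) (add_zero 1)
      map_add' := fun a b => by simp [Ext.mk₀_add]
      map_smul' := fun a b => by simp [Ext.mk₀_smul] }
  refine Module.Finite.of_surjective φ ?_
  intro e
  obtain ⟨x, hx⟩ := Ext.contravariant_sequence_exact₃ hS X e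
    (Ext.eq_zero_of_projective _) (n₀ := 0) rfl
  obtain ⟨g, rfl⟩ := Ext.addEquiv₀.symm.surjective x
  exact ⟨g, hx⟩

lemma reflect_fin (K : Type u) [Field K] [Algebra K A] [FiniteDimensional K A]
    {E : ModuleCat.{u} A} (X : ModuleCat.{u} A) (hE : Module.Finite A E) (hEE : E0 E E)
    (hX : Module.Finite A X) :
    ∃ (V : Type u) (Q : ModuleCat.{u} A) (i : X ⟶ Q) (p : Q ⟶ pw V E) (w : i ≫ p = 0),
      (ShortComplex.mk i p w).ShortExact ∧ E0 E Q ∧ Module.Finite A Q := by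
  have := fin_ext K E X hE hX
  obtain ⟨s, hs⟩ := this.fg_top
  obtain ⟨Q, i, p, w, h, hh⟩ := univ_ext (fun e : s => (e : X1 E X))
  refine ⟨_, Q, i, p, w, h, E0_refl K h hE hEE fun e => ?_, ?_⟩
  · have he : e ∈ Submodule.span K (s : Set (X1 E X)) := by rw [hs]; trivial
    induction he using Submodule.span_induction with
    | mem x hx => exact comp_i h ⟨x, hx⟩ x (hh ⟨x, hx⟩)
    | zero => simp
    | add x y _ _ hx hy => rw [Ext.add_comp, hx, hy]; simp
    | smul a x _ hx => rw [Ext.smul_comp, hx]; simp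
  · have h1 := (ShortComplex.ShortExact.moduleCat_exact_iff_function_exact _).1 h.exact
    have : Module.Finite A (pw s E) := by
      change Module.Finite A (s →₀ E); infer_instance
    have h2 : Function.Surjective p := (ModuleCat.epi_iff_surjective p).1 h.epi_g
    exact Module.Finite.of_exact (f := i.hom) (g := p.hom) h1 h2
end fd2

lemma van {K : Type u} [Field K] [Algebra K A] [FiniteDimensional K A] (hA : Hereditary A)
    {n : ℕ} (E : Fin n → ModuleCat.{u} A) (hE : IsExcSeq E)
    (hzero : ∀ C, (∀ j, PP (E j) C) → ∀ Y : ModuleCat.{u} A, E0 Y C) (m : ℕ) :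
    ∀ C, (∀ j : Fin n, m ≤ j.val → PP (E j) C) → ∀ Y, (∀ j : Fin n, j.val < m → PP Y (E j)) →
      E0 Y C := by
  induction m with
  | zero => intro C hC Y _; exact hzero C (fun j => hC j (Nat.zero_le _)) Y
  | succ m ih =>
    intro C hC Y hY
    by_cases hm : m < n
    · let k : Fin n := ⟨m, hm⟩
      have hfin := (hE.1 k).1
      have hEE : E0 (E k) (E k) := (extZero_iff _ _).1 (hE.1 k).2.1
      obtain ⟨V, Q, i, p, w, h, hQ⟩ := reflect K C hfin hEE
      have h1 : E0 Y (qm Q (tr (E k) Q)) := by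
        refine ih _ (fun j hj => ?_) Y (fun j hj => hY j (by omega))
        rcases hj.eq_or_lt with hj | hj
        · obtain rfl : k = j := Fin.ext hj
          exact PP_coker K hA hfin hEE hQ
        · have hjk : PP (E j) (E k) := (rperp_iff _ _).1 (hE.2 k j hj)
          exact PP_q hA _ (PP_pw K hfin _ hjk)
            (PP_2 h (hC j hj) (PP_pw K hfin _ hjk))
      have h2 : E0 Y (sm Q (tr (E k) Q)) :=
        E0_rg hA _ (E0_finsupp_right K hfin _ (hY k (Nat.lt_succ_self m)).2)
      have h3 : E0 Y Q := E0_cov2 (subSES_exact Q (tr (E k) Q)) h2 h1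
      exact E0_cov1 h (hz_finsupp_right V (hY k (Nat.lt_succ_self m)).1) h3
    · exact ih C (fun j hj => by omega) Y (fun j hj => hY j (by omega))

lemma gen {K : Type u} [Field K] [Algebra K A] [FiniteDimensional K A] (hA : Hereditary A)
    {n : ℕ} (E : Fin n → ModuleCat.{u} A) (hE : IsExcSeq E) (d : ℕ) :
    ∀ m, m + d = n → ∃ L : ModuleCat.{u} A, Module.Finite A L ∧
      (∀ j : Fin n, m ≤ j.val → PP (E j) L) ∧
      ∀ C, (∀ j : Fin n, m ≤ j.val → PP (E j) C) → E0 L C ∧ (homZero L C → Subsingleton C) := by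
  induction d with
  | zero =>
    intro m hm
    refine ⟨ModuleCat.of A A, by change Module.Finite A A; infer_instance,
      fun j hj => by omega, fun C _ => ⟨?_, ?_⟩⟩
    · have : Projective (ModuleCat.of A A) := by
        rw [← IsProjective.iff_projective]; infer_instance
      intro e
      exact Ext.eq_zero_of_projective _
    · intro h
      refine subsingleton_of_forall_eq 0 fun c => ?_
      have := congr($(h (ModuleCat.ofHom (LinearMap.toSpanSingleton A C c))).hom (1 : A))
      simpa using this
  | succ d ih =>
    intro m hm
    obtain ⟨L, hLf, hL, hLC⟩ := ih (m + 1) (by omega)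
    let k : Fin n := ⟨m, by omega⟩
    have hfin := (hE.1 k).1
    have hEE : E0 (E k) (E k) := (extZero_iff _ _).1 (hE.1 k).2.1
    obtain ⟨V, Q, i, p, w, h, hQ, hQf⟩ := reflect_fin K L hfin hEE hLf
    have hs := subSES_exact Q (tr (E k) Q)
    refine ⟨qm Q (tr (E k) Q), ?_, ?_, ?_⟩
    · change Module.Finite A (Q ⧸ (tr (E k) Q)); infer_instance
    · intro j hj
      rcases hj.eq_or_lt with hj | hj
      · obtain rfl : k = j := Fin.ext hj
        exact PP_coker K hA hfin hEE hQ
      · have hjk : PP (E j) (E k) := (rperp_iff _ _).1 (hE.2 k j hj)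
        exact PP_q hA _ (PP_pw K hfin _ hjk)
          (PP_2 h (hL j hj) (PP_pw K hfin _ hjk))
    · intro C hC
      have hk := hC k le_rfl
      obtain ⟨hC1, hC2⟩ := hLC C (fun j hj => hC j (by omega))
      have ht : homZero (sm Q (tr (E k) Q)) C := hz_rg _ (hz_finsupp_left _ hk.1)
      refine ⟨E0_con3 hs ht (E0_con2 h hC1 (E0_finsupp_left V hk.2)), fun hz => hC2 fun f => ?_⟩
      obtain ⟨g, rfl⟩ := desc_of_E0 h (E0_finsupp_left V hk.2) f
      obtain ⟨g', hg'⟩ : ∃ g' : qm Q (tr (E k) Q) ⟶ C, (subSES Q (tr (E k) Q)).g ≫ g' = g := by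
        have := hs.epi_g
        exact ⟨hs.exact.desc g (ht _), hs.exact.g_desc _ _⟩
      rw [← hg', hz g']; simp

lemma hzero' {K : Type u} [Field K] [Algebra K A] [FiniteDimensional K A] (hA : Hereditary A)
    {n : ℕ} (E : Fin n → ModuleCat.{u} A) (hE : CompleteES E) (C : ModuleCat.{u} A)
    (hC : ∀ j, PP (E j) C) : Subsingleton C := by
  obtain ⟨L, hLf, hL, hLC⟩ := gen (K := K) hA E hE.1 n 0 (by omega)
  by_contra hns
  have hLn : Nontrivial L := by
    by_contra hn
    rw [not_nontrivial_iff_subsingleton] at hn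
    refine hns ((hLC C fun j _ => hC j).2 fun f => ?_)
    ext x
    rw [Subsingleton.elim x 0]; simp
  let G : Set (ModuleCat.{u} A) := {M | Module.Finite A M ∧ Nontrivial M ∧ (∀ j, PP (E j) M) ∧
    ∀ C, (∀ j, PP (E j) C) → E0 M C}
  have hG : G.Nonempty := ⟨L, hLf, hLn, fun j => hL j (Nat.zero_le _),
    fun C hC => (hLC C fun j _ => hC j).1⟩
  obtain ⟨M, ⟨hMf, hMn, hMp, hMe⟩, hmin⟩ := WellFounded.has_min
    (InvImage.wf (fun M : ModuleCat.{u} A => Module.length A M) wellFounded_lt) G hG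
  have : IsArtinianRing A := IsArtinianRing.of_finite K A
  have hex : ExceptionalMod M := by
    refine ⟨hMf, (extZero_iff _ _).2 (hMe M hMp), hMn, fun f hf => ?_⟩
    have hsurj : rg f = ⊤ := by
      by_contra hne
      refine hmin (sm M (rg f)) ⟨?_, ?_, ?_, ?_⟩ (Submodule.length_lt hne)
      · change Module.Finite A (rg f); infer_instance
      · change Nontrivial (rg f)
        rw [Submodule.nontrivial_iff_ne_bot]
        intro hb
        apply hf
        apply ModuleCat.hom_ext
        exact LinearMap.range_eq_bot.1 hb
      · intro j; exact PP_rg hA f (hMp j) (hMp j)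
      · intro C hC
        exact E0_con1 hA (subSES_exact M (rg f)) (hMe C hC)
    have hs : Function.Surjective f.hom := LinearMap.range_eq_top.1 hsurj
    have hi := IsNoetherian.injective_of_surjective_endomorphism f.hom hs
    rw [ConcreteCategory.isIso_iff_bijective]
    exact ⟨hi, hs⟩
  have := hE.2 (n + 1) (Fin.cons M E) ⟨?_, ?_⟩
  · omega
  · intro i
    refine Fin.cases ?_ (fun i => ?_) i
    · exact hex
    · exact hE.1.1 i
  · intro i j
    refine Fin.cases ?_ (fun j => ?_) j
    · intro h; exact absurd h (Fin.not_lt_zero i)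
    refine Fin.cases ?_ (fun i => ?_) i
    · intro _; exact (rperp_iff _ _).2 (hMp j)
    · intro h; exact hE.1.2 i j (Fin.succ_lt_succ_iff.1 h)

lemma hzeroE {K : Type u} [Field K] [Algebra K A] [FiniteDimensional K A] (hA : Hereditary A)
    {n : ℕ} (E : Fin n → ModuleCat.{u} A) (hE : CompleteES E) (C : ModuleCat.{u} A)
    (hC : ∀ j, PP (E j) C) (Y : ModuleCat.{u} A) : E0 Y C := by
  have hs := hzero' (K := K) hA E hE C hC
  intro e
  rw [← Ext.comp_mk₀_id e]
  have : 𝟙 C = 0 := by ext x; exact Subsingleton.elim (α := C) _ _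
  rw [this]; simp

lemma basis_ex {F : ModuleCat.{u} A} (X : ModuleCat.{u} A) (hF : ExceptionalMod F) :
    ∃ (V : Type u) (e : V → X1 F X),
      (∀ T : AddSubgroup (X1 F X), (∀ v, e v ∈ T) →
        (∀ (d : F ⟶ F), ∀ x ∈ T, (Ext.mk₀ d).comp x (zero_add 1) ∈ T) → ∀ x, x ∈ T) ∧
      (∀ (s : Finset V) (d : V → (F ⟶ F)),
        ∑ v ∈ s, (Ext.mk₀ (d v)).comp (e v) (zero_add 1) = 0 → ∀ v ∈ s, d v = 0) := by
  let D := (End F)ᵐᵒᵖ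
  have hnt : Nontrivial (End F) := by
    refine ⟨⟨𝟙 F, 0, fun h => ?_⟩⟩
    obtain ⟨x, hx⟩ := (nontrivial_iff_exists_ne (0 : F)).1 hF.2.2.1
    exact hx congr($(h).hom x)
  have hD : ∀ a : D, IsUnit a ∨ a = 0 := by
    intro a
    by_cases h : a = 0
    · exact Or.inr h
    · left
      have h1 : a.unop ≠ 0 := fun h' => h (MulOpposite.unop_injective h')
      have h2 : IsIso (a.unop : F ⟶ F) := hF.2.2.2 _ h1
      have : IsUnit a.unop := isUnit_iff_exists.2 ⟨inv (a.unop : F ⟶ F),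
        IsIso.inv_hom_id (a.unop : F ⟶ F), IsIso.hom_inv_id (a.unop : F ⟶ F)⟩
      exact this.op
  let : DivisionRing D := DivisionRing.ofIsUnitOrEqZero hD
  let : Module D (X1 F X) :=
    { smul := fun d x => (Ext.mk₀ (d.unop : F ⟶ F)).comp x (zero_add 1)
      one_smul := fun x => Ext.mk₀_id_comp x
      mul_smul := fun a b x => by
        change (Ext.mk₀ ((a.unop : F ⟶ F) ≫ (b.unop : F ⟶ F))).comp x (zero_add 1) = _
        rw [← Ext.mk₀_comp_mk₀_assoc]; rfl
      smul_zero := fun a => Ext.comp_zero _ _ _ _ _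
      smul_add := fun a x y => Ext.comp_add _ _ _ _
      add_smul := fun a b x => by
        change (Ext.mk₀ ((a.unop : F ⟶ F) + (b.unop : F ⟶ F))).comp x (zero_add 1) = _
        rw [Ext.mk₀_add, Ext.add_comp]; rfl
      zero_smul := fun x => by
        change (Ext.mk₀ (0 : F ⟶ F)).comp x (zero_add 1) = _
        simp }
  let B := Module.Basis.ofVectorSpace D (X1 F X)
  refine ⟨_, B, fun T hT hT' x => ?_, fun s d h v hv => ?_⟩
  · let T' : Submodule D (X1 F X) :=
      { T with smul_mem' := fun c x hx => hT' c.unop x hx }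
    have : Submodule.span D (Set.range B) ≤ T' :=
      Submodule.span_le.2 (by rintro _ ⟨v, rfl⟩; exact hT v)
    exact this (B.mem_span x)
  · have := linearIndependent_iff'.1 B.linearIndependent s (fun v => MulOpposite.op (d v)) h v hv
    exact MulOpposite.op_injective this

lemma dich {K : Type u} [Field K] [Algebra K A] [FiniteDimensional K A] (hA : Hereditary A)
    {n : ℕ} (E : Fin n → ModuleCat.{u} A) (hE : CompleteES E) (k : Fin n) (X Y : ModuleCat.{u} A)
    (hX : ∀ j, k < j → PP (E j) X) (hX' : ¬ E0 (E k) X) (hY : ∀ j, j < k → PP Y (E j)) :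
    E0 Y (E k) := by
  have hfin := (hE.1.1 k).1
  have hEE : E0 (E k) (E k) := (extZero_iff _ _).1 (hE.1.1 k).2.1
  obtain ⟨V, e, hsp, hind⟩ := basis_ex X (hE.1.1 k)
  have hV : Nonempty V := by
    by_contra hV
    apply hX'
    intro x
    refine hsp ⊥ (fun v => (hV ⟨v⟩).elim) (fun d x hx => ?_) x
    rw [AddSubgroup.mem_bot] at hx ⊢
    rw [hx]; simp
  obtain ⟨v0⟩ := hV
  obtain ⟨Q, i, p, w, h, hQe⟩ := univ_ext e
  let T : AddSubgroup (X1 (E k) X) :=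
    { carrier := {x | x.comp (Ext.mk₀ i) (add_zero 1) = 0}
      add_mem' := fun {a b} ha hb => by
        simp only [Set.mem_ofPred_eq] at ha hb ⊢
        rw [Ext.add_comp, ha, hb, add_zero]
      zero_mem' := by simp
      neg_mem' := fun {a} ha => by
        simp only [Set.mem_ofPred_eq] at ha ⊢
        rw [Ext.neg_comp, ha, neg_zero] }
  have hQ : E0 (E k) Q := by
    refine E0_refl K h hfin hEE fun x => hsp T (fun v => comp_i h v _ (hQe v)) (fun d x hx => ?_) x
    change x.comp (Ext.mk₀ i) (add_zero 1) = 0 at hx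
    change ((Ext.mk₀ d).comp x (zero_add 1)).comp (Ext.mk₀ i) (add_zero 1) = 0
    rw [Ext.comp_assoc_of_third_deg_zero, hx]; simp
  have hmap : ∀ g : E k ⟶ Q, g ≫ p = 0 := by
    intro g
    set f := g ≫ p with hf
    classical
    obtain ⟨t, ht⟩ := hfin.fg_top
    let s : Finset V := t.biUnion fun x => (f.hom x).support
    have hsupp : ∀ x : E k, (f.hom x).support ⊆ s := by
      intro x
      have hx : x ∈ Submodule.span A (t : Set (E k)) := ht ▸ Submodule.mem_top
      induction hx using Submodule.span_induction with
      | mem x hx => exact Finset.subset_biUnion_of_mem (fun x => (f.hom x).support) hx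
      | zero => simp
      | add x y _ _ h1 h2 =>
        rw [map_add]
        exact Finsupp.support_add.trans (Finset.union_subset h1 h2)
      | smul a x _ h1 =>
        rw [map_smul]
        exact Finsupp.support_smul.trans h1
    have hsum : f = ∑ v ∈ s, (f ≫ pv (E k) v) ≫ iv (E k) v := by
      apply ModuleCat.hom_ext
      refine LinearMap.ext fun x => ?_
      rw [ModuleCat.hom_sum, LinearMap.sum_apply]
      have h1 : f.hom x = ∑ v ∈ s, Finsupp.single v (f.hom x v) := by
        conv_lhs => rw [← Finsupp.sum_single (f.hom x)]
        exact Finsupp.sum_of_support_subset _ (hsupp x) _ (by simp)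
      exact h1
    have hz : (Ext.mk₀ f).comp (h.extClass : X1 _ _) (zero_add 1) = 0 := by
      rw [hf, ← Ext.mk₀_comp_mk₀_assoc]
      have := h.comp_extClass
      dsimp only at this
      rw [this]; simp
    have hz2 : ∑ v ∈ s, (Ext.mk₀ (f ≫ pv (E k) v)).comp (e v) (zero_add 1) = 0 := by
      let φ : (E k ⟶ pw V (E k)) →+ X1 (E k) X :=
        AddMonoidHom.mk' (fun f => (Ext.mk₀ f).comp (h.extClass : X1 _ _) (zero_add 1))
          (fun a b => by rw [Ext.mk₀_add, Ext.add_comp])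
      have hφ : φ (∑ v ∈ s, (f ≫ pv (E k) v) ≫ iv (E k) v) = 0 := by
        rw [← hsum]; exact hz
      rw [map_sum] at hφ
      rw [← hφ]
      refine Finset.sum_congr rfl fun v _ => ?_
      change _ = (Ext.mk₀ ((f ≫ pv (E k) v) ≫ iv (E k) v)).comp (h.extClass : X1 _ _) (zero_add 1)
      rw [← hQe v, Ext.mk₀_comp_mk₀_assoc]
    have hz3 := hind s _ hz2
    rw [hsum]
    exact Finset.sum_eq_zero fun v hv => by rw [hz3 v hv]; simp
  have hs := subSES_exact Q (tr (E k) Q)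
  have hincl : (subSES Q (tr (E k) Q)).f ≫ p = 0 := by
    apply ModuleCat.hom_ext
    refine LinearMap.ext fun ⟨x, hx⟩ => ?_
    obtain ⟨y, rfl⟩ := hx
    have : tm (E k) Q ≫ p = 0 := by
      apply ModuleCat.hom_ext
      refine Finsupp.lhom_ext' fun g => LinearMap.ext fun z => ?_
      have := congr($(hmap g).hom z)
      simpa using this
    exact congr($(this).hom y)
  have h1 : E0 Y (qm Q (tr (E k) Q)) := by
    refine van (K := K) hA E hE.1 (hzeroE (K := K) hA E hE) k.val _ (fun j hj => ?_) Y
      (fun j hj => hY j hj)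
    rcases hj.eq_or_lt with hj | hj
    · obtain rfl : k = j := Fin.ext hj
      exact PP_coker K hA hfin hEE hQ
    · have hjk : PP (E j) (E k) := (rperp_iff _ _).1 (hE.1.2 k j hj)
      exact PP_q hA _ (PP_pw K hfin _ hjk)
        (PP_2 h (hX j hj) (PP_pw K hfin _ hjk))
  intro y
  have hy : y.comp (Ext.mk₀ (iv (E k) v0)) (add_zero 1) = 0 := by
    obtain ⟨q, hq⟩ := Ext.covariant_sequence_exact₃ Y h
      (y.comp (Ext.mk₀ (iv (E k) v0)) (add_zero 1)) (n₁ := 2) rfl (ext2 hA _)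
    obtain ⟨t, rfl⟩ := Ext.covariant_sequence_exact₂ Y hs q (h1 _)
    rw [← hq, Ext.comp_assoc_of_third_deg_zero, Ext.mk₀_comp_mk₀]
    dsimp only at hincl ⊢
    rw [hincl]; simp
  have hip : iv (E k) v0 ≫ pv (E k) v0 = 𝟙 _ := by
    ext x; simp
  rw [← Ext.comp_mk₀_id y, ← hip, ← Ext.mk₀_comp_mk₀, ← Ext.comp_assoc_of_third_deg_zero, hy]
  simp

lemma final {K : Type u} [Field K] [Algebra K A] [FiniteDimensional K A] (hA : Hereditary A)
    {n : ℕ} (E : Fin n → ModuleCat.{u} A) (hE : CompleteES E) (k : Fin n) :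
    RelProj E k ∨ RelInj E k := by
  by_cases hP : ∀ X, Aperp E k X → E0 (E k) X
  · left
    refine ⟨fun j hj => hE.1.2 k j hj, fun Y Z hY hZ p hp f => ?_⟩
    have hs := kerSES_exact p ((ModuleCat.epi_iff_surjective p).1 hp)
    refine lift_of_E0 hs (hP _ fun j hj => (rperp_iff _ _).2 ?_) f
    have h1 := (rperp_iff _ _).1 (hY j hj)
    have h2 := (rperp_iff _ _).1 (hZ j hj)
    exact ⟨hz_cov1 hs h1.1, E0_cov1 hs h2.1 h1.2⟩
  · right
    push Not at hP
    obtain ⟨X, hX, hX'⟩ := hP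
    refine ⟨fun j hj => (lperp_iff _ _).2 ((rperp_iff _ _).1 (hE.1.2 j k hj)),
      fun Y Z hY hZ i hi f => ?_⟩
    have hs : (ShortComplex.mk (X₃ := qm Z (rg i)) i (ModuleCat.ofHom (rg i).mkQ) (by
        ext x
        exact (Submodule.Quotient.mk_eq_zero _).2 ⟨x, rfl⟩)).ShortExact := by
      apply mkSES
      · exact (ModuleCat.mono_iff_injective i).1 hi
      · exact (rg i).mkQ_surjective
      · intro y hy
        exact (Submodule.Quotient.mk_eq_zero _).1 hy
    refine desc_of_E0 hs (dich (K := K) hA E hE k X _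
      (fun j hj => (rperp_iff _ _).1 (hX j hj)) hX' fun j hj => ?_) f
    have h1 := (lperp_iff _ _).1 (hY j hj)
    have h2 := (lperp_iff _ _).1 (hZ j hj)
    exact ⟨hz_con3 hs h2.1, E0_con3 hs h1.1 h2.2⟩

end helpers

/-- **Theorem A.** Every term of a complete exceptional sequence over a
finite-dimensional hereditary algebra is relatively projective or relatively injective
(or both). -/
theorem stmt3 {K : Type u} [Field K] {A : Type u} [Ring A] [Algebra K A]
    [FiniteDimensional K A] (hA : Hereditary A)
    {n : ℕ} (E : Fin n → ModuleCat.{u} A) (hE : CompleteES E) (k : Fin n) :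
    RelProj E k ∨ RelInj E k := by
  exact final (K := K) hA E hE k

end ExcSeq
end

section
/- Let (E₁,…,Eₙ) be a complete exceptional sequence over a hereditary algebra Λ. Then Eₖ is relatively projective if and only if there is no epimorphism X ↠ Eₖ with X ∈ 𝒜_{k−1} = (Eₖ⊕E_{k+1}⊕⋯⊕Eₙ)^⊥. -/
open CategoryTheory

universe u

variable {A : Type u} [Ring A]

namespace ExcSeq

section helpers

variable {A : Type u} [Ring A]

lemma fac_inj {P M X : Type u} [AddCommGroup P] [Module A P] [AddCommGroup M] [Module A M]
    [AddCommGroup X] [Module A X] (j : M →ₗ[A] X) (hj : Function.Injective j)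
    (f : P →ₗ[A] X) (h : ∀ x, f x ∈ LinearMap.range j) : ∃ g : P →ₗ[A] M, ∀ x, j (g x) = f x := by
  refine ⟨(LinearEquiv.ofInjective j hj).symm.toLinearMap ∘ₗ f.codRestrict _ h, fun x => ?_⟩
  have := (LinearEquiv.ofInjective j hj).apply_symm_apply (f.codRestrict _ h x)
  simpa using congrArg Subtype.val this

lemma fac_surj {P E X : Type u} [AddCommGroup P] [Module A P] [AddCommGroup E] [Module A E]
    [AddCommGroup X] [Module A X] (q : P →ₗ[A] E) (hq : Function.Surjective q)
    (f : P →ₗ[A] X) (h : ∀ x, q x = 0 → f x = 0) : ∃ g : E →ₗ[A] X, ∀ x, g (q x) = f x := by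
  refine ⟨(LinearMap.ker q).liftQ f (fun x hx => h x hx) ∘ₗ
    (q.quotKerEquivOfSurjective hq).symm.toLinearMap, fun x => ?_⟩
  have : (q.quotKerEquivOfSurjective hq).symm (q x) = (LinearMap.ker q).mkQ x := by
    rw [LinearEquiv.symm_apply_eq]; rfl
  rw [LinearMap.comp_apply, LinearEquiv.coe_coe, this]
  rfl

/-- extension property encoding vanishing of Ext -/
def EZ {P E : Type u} [AddCommGroup P] [Module A P] [AddCommGroup E] [Module A E]
    (q : P →ₗ[A] E) (N : Type u) [AddCommGroup N] [Module A N] : Prop :=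
  ∀ f : LinearMap.ker q →ₗ[A] N, ∃ g : P →ₗ[A] N, ∀ x : LinearMap.ker q, g x = f x

section
variable {P E N N' N'' : Type u} [AddCommGroup P] [Module A P] [AddCommGroup E] [Module A E]
  [AddCommGroup N] [Module A N] [AddCommGroup N'] [Module A N'] [AddCommGroup N''] [Module A N'']
  (q : P →ₗ[A] E)

lemma EZ.quot [Module.Projective A (LinearMap.ker q)] (h : EZ q N) (p : N →ₗ[A] N')
    (hp : Function.Surjective p) : EZ q N' := by
  intro f
  obtain ⟨f', hf'⟩ := Module.projective_lifting_property p f hp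
  obtain ⟨g, hg⟩ := h f'
  exact ⟨p ∘ₗ g, fun x => by rw [← hf']; simp [hg]⟩

lemma EZ.ext [Module.Projective A P] (j : N' →ₗ[A] N) (p : N →ₗ[A] N'')
    (hj : Function.Injective j) (hp : Function.Surjective p) (hex : Function.Exact j p)
    (h'' : EZ q N'')
    (h' : ∀ f : LinearMap.ker q →ₗ[A] N', ∃ g : P →ₗ[A] N, ∀ x : LinearMap.ker q, g x = j (f x)) :
    EZ q N := by
  intro f
  obtain ⟨g, hg⟩ := h'' (p ∘ₗ f)
  obtain ⟨g', hg'⟩ := Module.projective_lifting_property p g hp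
  obtain ⟨f', hf'⟩ := fac_inj j hj (f - g' ∘ₗ (LinearMap.ker q).subtype) (fun x => by
    refine (hex _).1 ?_
    have := LinearMap.congr_fun hg' (x : P)
    have h2 := hg x
    simp at this h2
    simp [this, h2])
  obtain ⟨k, hk⟩ := h' f'
  exact ⟨k + g', fun x => by simp [hk, hf']⟩

lemma EZ.ker (hq : Function.Surjective q) (j : N' →ₗ[A] N) (p : N →ₗ[A] N'')
    (hj : Function.Injective j) (hex : Function.Exact j p)
    (h0 : ∀ f : E →ₗ[A] N'', f = 0) (h : EZ q N) : EZ q N' := by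
  intro f
  obtain ⟨g, hg⟩ := h (j ∘ₗ f)
  obtain ⟨k, hk⟩ := fac_surj q hq (p ∘ₗ g) (fun x hx => by
    have := hg ⟨x, hx⟩
    simp at this
    simp [this, hex.apply_apply_eq_zero])
  obtain ⟨g', hg'⟩ := fac_inj j hj g (fun x => (hex _).1 (by
    have := hk x
    rw [h0 k] at this
    simpa using this.symm))
  exact ⟨g', fun x => hj (by rw [hg', hg]; rfl)⟩

lemma EZ.lift [Module.Projective A P] (hq : Function.Surjective q) (j : N' →ₗ[A] N)
    (p : N →ₗ[A] N'')
    (hj : Function.Injective j) (hp : Function.Surjective p) (hex : Function.Exact j p)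
    (h : EZ q N') (f : E →ₗ[A] N'') : ∃ g : E →ₗ[A] N, ∀ x, p (g x) = f x := by
  obtain ⟨g, hg⟩ := Module.projective_lifting_property p (f ∘ₗ q) hp
  have hg' : ∀ x, p (g x) = f (q x) := fun x => LinearMap.congr_fun hg x
  obtain ⟨k, hk⟩ := fac_inj j hj (g ∘ₗ (LinearMap.ker q).subtype) (fun x => (hex _).1 (by
    have : q x = 0 := x.2
    simp [hg', this]))
  obtain ⟨k', hk'⟩ := h k
  obtain ⟨r, hr⟩ := fac_surj q hq (g - j ∘ₗ k') (fun x hx => by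
    have h1 := hk' ⟨x, hx⟩
    have h2 := hk ⟨x, hx⟩
    simp at h1 h2
    simp [h1, h2])
  refine ⟨r, fun x => ?_⟩
  obtain ⟨y, rfl⟩ := hq x
  rw [hr]
  simp [hg', hex.apply_apply_eq_zero]

lemma finsupp_decomp {I : Type u} [Module.Finite A N] (g : N →ₗ[A] (I →₀ E)) :
    ∃ s : Finset I, g = ∑ i ∈ s, Finsupp.lsingle i ∘ₗ Finsupp.lapply i ∘ₗ g := by
  classical
  obtain ⟨t, ht⟩ := (Module.finite_def (R := A) (M := N)).1 inferInstance
  have key : ∀ x : N, ((g x).support : Set I) ⊆ (t.biUnion fun y => (g y).support : Finset I) := by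
    intro x
    have hx : x ∈ Submodule.span A (t : Set N) := ht ▸ Submodule.mem_top
    have : Submodule.span A (t : Set N) ≤
        (Finsupp.supported E A ((t.biUnion fun y => (g y).support : Finset I) : Set I)).comap g := by
      rw [Submodule.span_le]
      intro y hy
      simp only [Submodule.comap_coe, Set.mem_preimage, SetLike.mem_coe, Finsupp.mem_supported]
      exact_mod_cast Finset.subset_biUnion_of_mem (fun y => (g y).support) hy
    exact this hx
  refine ⟨t.biUnion fun y => (g y).support, ?_⟩
  ext x i
  simp only [LinearMap.coe_sum, Finset.sum_apply, LinearMap.comp_apply, Finsupp.lsingle_apply,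
    Finsupp.lapply_apply, Finsupp.finsetSum_apply]
  by_cases hi : i ∈ t.biUnion fun y => (g y).support
  · rw [Finset.sum_eq_single i]
    · simp
    · intro b _ hb; simp [hb]
    · intro h; exact absurd hi h
  · have : g x i = 0 := by
      by_contra h
      exact hi (by exact_mod_cast key x (by simpa using h))
    rw [this, Finset.sum_eq_zero]
    intro b hb
    rw [Finsupp.single_apply, if_neg]
    rintro rfl; exact hi hb

lemma EZ.finsupp {I : Type u} [Module.Finite A (LinearMap.ker q)] (h : EZ q N) :
    EZ q (I →₀ N) := by
  intro f
  obtain ⟨s, hs⟩ := finsupp_decomp f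
  choose g hg using fun i => h (Finsupp.lapply i ∘ₗ f)
  refine ⟨∑ i ∈ s, Finsupp.lsingle i ∘ₗ g i, fun x => ?_⟩
  rw [hs]
  simp [hg]

lemma hom_finsupp {I : Type u} (h : ∀ f : E →ₗ[A] N, f = 0) (f : E →ₗ[A] (I →₀ N)) : f = 0 := by
  ext x i
  exact LinearMap.congr_fun (h (Finsupp.lapply i ∘ₗ f)) x

lemma hom_ext (j : N' →ₗ[A] N) (p : N →ₗ[A] N'')
    (hj : Function.Injective j) (hex : Function.Exact j p)
    (h' : ∀ f : E →ₗ[A] N', f = 0) (h'' : ∀ f : E →ₗ[A] N'', f = 0) (f : E →ₗ[A] N) : f = 0 := by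
  obtain ⟨g, hg⟩ := fac_inj j hj f (fun x => (hex _).1 (LinearMap.congr_fun (h'' (p ∘ₗ f)) x))
  ext x
  rw [← hg, h' g]; simp

end

lemma pushout_ex {W P E M : Type u} [AddCommGroup W] [Module A W] [AddCommGroup P] [Module A P]
    [AddCommGroup E] [Module A E] [AddCommGroup M] [Module A M]
    (i : W →ₗ[A] P) (q : P →ₗ[A] E) (hi : Function.Injective i) (hq : Function.Surjective q)
    (hex : Function.Exact i q) (f : W →ₗ[A] M) :
    ∃ (X : ModuleCat.{u} A) (j : M →ₗ[A] X) (v : P →ₗ[A] X) (π : X →ₗ[A] E),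
      Function.Injective j ∧ Function.Surjective π ∧ Function.Exact j π ∧
      (∀ w, v (i w) = j (f w)) ∧ ∀ x, π (v x) = q x := by
  let R : Submodule A (M × P) := LinearMap.range (f.prod (-i))
  have hR : ∀ a b, (a, b) ∈ R ↔ ∃ w, f w = a ∧ -i w = b := by
    intro a b; simp [R, LinearMap.mem_range]
  refine ⟨ModuleCat.of A ((M × P) ⧸ R), R.mkQ ∘ₗ LinearMap.inl A M P, R.mkQ ∘ₗ LinearMap.inr A M P,
    R.liftQ (q ∘ₗ LinearMap.snd A M P) ?_, ?_, ?_, ?_, ?_, ?_⟩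
  · rintro ⟨a, b⟩ hab
    obtain ⟨w, rfl, rfl⟩ := (hR _ _).1 hab
    simp [hex.apply_apply_eq_zero]
  · rw [injective_iff_map_eq_zero]
    intro a ha
    have : (a, (0 : P)) ∈ R := by simpa using ha
    obtain ⟨w, rfl, h⟩ := (hR _ _).1 this
    have : w = 0 := hi (by simpa using h)
    simp [this]
  · intro e
    obtain ⟨x, rfl⟩ := hq e
    exact ⟨R.mkQ (0, x), by simp⟩
  · intro y
    obtain ⟨⟨a, b⟩, rfl⟩ := R.mkQ_surjective y
    constructor
    · intro h
      have : q b = 0 := by simpa using h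
      obtain ⟨w, rfl⟩ := (hex _).1 this
      refine ⟨a + f w, ?_⟩
      show R.mkQ (a + f w, 0) = R.mkQ (a, i w)
      rw [← sub_eq_zero, ← map_sub, Submodule.mkQ_apply, Submodule.Quotient.mk_eq_zero]
      exact (hR _ _).2 ⟨w, by simp, by simp⟩
    · rintro ⟨c, hc⟩
      rw [← hc]
      simp
  · intro w
    show R.mkQ (0, i w) = R.mkQ (f w, 0)
    rw [eq_comm, ← sub_eq_zero, ← map_sub, Submodule.mkQ_apply, Submodule.Quotient.mk_eq_zero]
    exact (hR _ _).2 ⟨w, by simp, by simp⟩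
  · intro x; simp

lemma univ_ext_s4 {P E : Type u} [AddCommGroup P] [Module A P]
    [AddCommGroup E] [Module A E] (q : P →ₗ[A] E) (hq : Function.Surjective q)
    (M : Type u) [AddCommGroup M] [Module A M] :
    ∃ (X : ModuleCat.{u} A) (j : M →ₗ[A] X) (v : ((LinearMap.ker q →ₗ[A] M) →₀ P) →ₗ[A] X)
      (π : X →ₗ[A] ((LinearMap.ker q →ₗ[A] M) →₀ E)),
      Function.Injective j ∧ Function.Surjective π ∧ Function.Exact j π ∧
      (∀ i (w : LinearMap.ker q), v (Finsupp.single i (w : P)) = j (i w)) ∧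
      ∀ i x, π (v (Finsupp.single i x)) = Finsupp.single i (q x) := by
  let a : ((LinearMap.ker q →ₗ[A] M) →₀ LinearMap.ker q) →ₗ[A] ((LinearMap.ker q →ₗ[A] M) →₀ P) :=
    Finsupp.mapRange.linearMap (LinearMap.ker q).subtype
  let b : ((LinearMap.ker q →ₗ[A] M) →₀ P) →ₗ[A] ((LinearMap.ker q →ₗ[A] M) →₀ E) :=
    Finsupp.mapRange.linearMap q
  have ha : Function.Injective a :=
    Finsupp.mapRange_injective _ (map_zero _) (LinearMap.ker q).injective_subtype
  have hb : Function.Surjective b := Finsupp.mapRange_surjective _ (map_zero _) hq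
  have hab : Function.Exact a b := by
    intro y
    constructor
    · intro h
      have h' : ∀ i, q (y i) = 0 := fun i => by
        simpa [b] using DFunLike.congr_fun h i
      refine ⟨Finsupp.onFinset y.support (fun i => ⟨y i, h' i⟩) ?_, ?_⟩
      · intro i hi
        rw [Finsupp.mem_support_iff]
        intro h0
        exact hi (Subtype.ext h0)
      · ext i : 1
        simp [a]
    · rintro ⟨z, rfl⟩
      ext i
      simp [a, b]
  obtain ⟨X, j, v, π, hj, hπ, hex, hv, hqv⟩ := pushout_ex a b ha hb hab
    (Finsupp.lsum ℕ (fun g => g))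
  refine ⟨X, j, v, π, hj, hπ, hex, fun i w => ?_, fun i x => ?_⟩
  · simpa [a] using hv (Finsupp.single i w)
  · simp [hqv, b]

lemma homZero_iff (X Y : ModuleCat.{u} A) : homZero X Y ↔ ∀ f : X →ₗ[A] Y, f = 0 := by
  constructor
  · intro h f
    have := congrArg ModuleCat.Hom.hom (h (ModuleCat.ofHom f))
    simpa using this
  · intro h f
    ext1
    exact h f.hom

lemma extZero_iff_s4 {P : Type u} [AddCommGroup P] [Module A P] [Module.Projective A P]
    (X Y : ModuleCat.{u} A) (q : P →ₗ[A] X) (hq : Function.Surjective q) :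
    extZero X Y ↔ EZ q Y := by
  constructor
  · intro h f
    obtain ⟨Z, j, v, π, hj, hπ, hex, hv, hqv⟩ := pushout_ex (LinearMap.ker q).subtype q
      (LinearMap.ker q).injective_subtype hq (LinearMap.exact_subtype_ker_map q) f
    obtain ⟨s, hs⟩ := h Z (ModuleCat.ofHom j) (ModuleCat.ofHom π)
      (by ext x; simpa using hex.apply_apply_eq_zero x)
      (ModuleCat.shortComplex_shortExact _ hex hj hπ)
    have hs' : ∀ x, π (s.hom x) = x := fun x => by
      have := congrArg (fun t => t.hom x) hs
      simpa using this
    obtain ⟨g, hg⟩ := fac_inj j hj (v - s.hom ∘ₗ q) (fun x => (hex _).1 (by simp [hqv, hs']))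
    refine ⟨g, fun x => hj ?_⟩
    have hx : q x = 0 := x.2
    rw [hg, ← hv]
    simp [hx]
  · intro h Z i p w hS
    obtain ⟨g, hg⟩ := EZ.lift q hq i.hom p.hom hS.moduleCat_injective_f hS.moduleCat_surjective_g
      ((ShortComplex.ShortExact.moduleCat_exact_iff_function_exact _).1 hS.exact) h LinearMap.id
    exact ⟨ModuleCat.ofHom g, by ext x; exact hg x⟩

lemma exists_functional {D H : Type u} [Ring D] [Nontrivial D]
    (hD : ∀ a : D, IsUnit a ∨ a = 0) [AddCommGroup H] [Module D H] (V : Submodule D H)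
    (hV : V < ⊤) : ∃ f : H →ₗ[D] D, f ≠ 0 ∧ V ≤ LinearMap.ker f := by
  letI : DivisionRing D := DivisionRing.ofIsUnitOrEqZero hD
  exact Submodule.exists_le_ker_of_lt_top V hV

lemma exists_theta {E : Type u} [AddCommGroup E] [Module A E] [Module.Finite A E] [Nontrivial E]
    (hD : ∀ f : E →ₗ[A] E, f ≠ 0 → Function.Bijective f) {I : Type u} {X : Type u}
    [AddCommGroup X] [Module A X] (π : X →ₗ[A] (I →₀ E)) (g₀ : E →ₗ[A] (I →₀ E))
    (hg₀ : ¬ ∃ g : E →ₗ[A] X, π ∘ₗ g = g₀) :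
    ∃ θ : (I →₀ E) →ₗ[A] E, Function.Surjective θ ∧ ∀ g : E →ₗ[A] X, θ ∘ₗ π ∘ₗ g = 0 := by
  have hU : ∀ a : (Module.End A E)ᵈᵐᵃ, IsUnit a ∨ a = 0 := by
    intro a
    by_cases h : DomMulAct.mk.symm a = 0
    · right; exact DomMulAct.mk.symm.injective (h.trans rfl)
    · left
      have := (Module.End.isUnit_iff _).2 (hD _ h)
      exact (this.op : IsUnit (MulOpposite.op (DomMulAct.mk.symm a)))
  haveI : Nontrivial (Module.End A E)ᵈᵐᵃ := inferInstanceAs (Nontrivial (Module.End A E)ᵐᵒᵖ)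
  let V : Submodule (Module.End A E)ᵈᵐᵃ (E →ₗ[A] (I →₀ E)) :=
    { carrier := {h | ∃ g : E →ₗ[A] X, π ∘ₗ g = h}
      add_mem' := by
        rintro _ _ ⟨a, rfl⟩ ⟨b, rfl⟩
        exact ⟨a + b, LinearMap.comp_add _ _ _⟩
      zero_mem' := ⟨0, LinearMap.comp_zero _⟩
      smul_mem' := by
        rintro c _ ⟨a, rfl⟩
        exact ⟨c • a, rfl⟩ }
  obtain ⟨f, hf0, hf⟩ := exists_functional hU V (lt_top_iff_ne_top.2 (fun h => hg₀ (by
    have : g₀ ∈ V := h ▸ Submodule.mem_top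
    exact this)))
  let d : I → (E →ₗ[A] E) := fun i => DomMulAct.mk.symm (f (Finsupp.lsingle i))
  let θ : (I →₀ E) →ₗ[A] E := Finsupp.lsum ℕ d
  have key : ∀ g : E →ₗ[A] (I →₀ E), DomMulAct.mk.symm (f g) = θ ∘ₗ g := by
    intro g
    obtain ⟨s, hs⟩ := finsupp_decomp g
    have h1 : ∀ i, Finsupp.lsingle i ∘ₗ Finsupp.lapply i ∘ₗ g =
      (DomMulAct.mk (Finsupp.lapply i ∘ₗ g : Module.End A E)) • (Finsupp.lsingle i : E →ₗ[A] (I →₀ E)) := by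
      intro i; rfl
    have h2 : f g = ∑ i ∈ s, DomMulAct.mk (d i * (Finsupp.lapply i ∘ₗ g : Module.End A E)) := by
      conv_lhs => rw [hs]
      rw [map_sum]
      refine Finset.sum_congr rfl fun i _ => ?_
      rw [h1, map_smul]; rfl
    rw [h2]
    have h3 : ∀ F : I → Module.End A E, DomMulAct.mk.symm (∑ i ∈ s, DomMulAct.mk (F i)) = ∑ i ∈ s, F i := by
      intro F
      exact map_sum (MulOpposite.opAddEquiv (α := Module.End A E)).symm _ _
    rw [h3]
    conv_rhs => rw [hs]
    ext x
    rw [LinearMap.comp_apply, LinearMap.sum_apply, LinearMap.sum_apply, map_sum]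
    simp [θ]
  refine ⟨θ, ?_, fun g => ?_⟩
  · have : ∃ i, d i ≠ 0 := by
      by_contra! hc
      apply hf0
      refine LinearMap.ext fun g => ?_
      have h1 := key g
      have h2 : θ = 0 := by
        ext i x
        simp [θ, hc]
      rw [h2, LinearMap.zero_comp] at h1
      exact DomMulAct.mk.symm.injective (h1.trans rfl)
    obtain ⟨i, hi⟩ := this
    intro y
    obtain ⟨x, rfl⟩ := (hD _ hi).2 y
    exact ⟨Finsupp.single i x, by simp [θ]⟩
  · rw [← key]
    have : f (π ∘ₗ g) = 0 := hf (show π ∘ₗ g ∈ V from ⟨g, rfl⟩)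
    rw [this]; rfl

lemma exists_pres {K : Type u} [Field K] [Algebra K A]
    [FiniteDimensional K A] (hA : Hereditary A) (E : ModuleCat.{u} A) [Module.Finite A E] :
    ∃ (m : ℕ) (q : (Fin m → A) →ₗ[A] E), Function.Surjective q ∧
      Module.Finite A (LinearMap.ker q) ∧ Module.Projective A (LinearMap.ker q) := by
  haveI : IsNoetherianRing A := isNoetherian_of_tower K inferInstance
  obtain ⟨m, q, hq⟩ := Module.Finite.exists_fin' A E
  refine ⟨m, q, hq, inferInstance, ?_⟩
  rw [IsProjective.iff_projective]
  exact hA (ModuleCat.of A (Fin m → A)) ((IsProjective.iff_projective _).1 inferInstance) _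

/-- The trace of `E` in `X`. -/
noncomputable def traceMap (E X : Type u) [AddCommGroup E] [Module A E] [AddCommGroup X]
    [Module A X] : ((E →ₗ[A] X) →₀ E) →ₗ[A] X := Finsupp.lsum ℕ (fun g => g)

end helpers

/-- `Eₖ` is relatively projective if and only if there is no epimorphism
`X ↠ Eₖ` with `X ∈ 𝒜_{k-1} = (Eₖ ⊕ ⋯ ⊕ Eₙ)^⊥`. -/
theorem stmt4 {K : Type u} [Field K] {A : Type u} [Ring A] [Algebra K A]
    [FiniteDimensional K A] (hA : Hereditary A)
    {n : ℕ} (E : Fin n → ModuleCat.{u} A) (hE : CompleteES E) (k : Fin n) :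
    RelProj E k ↔
      ¬ ∃ (X : ModuleCat.{u} A) (p : X ⟶ E k),
          (∀ j : Fin n, k ≤ j → rperp (E j) X) ∧ Epi p := by
  constructor
  · rintro ⟨hk, hproj⟩ ⟨X, p, hX, hp⟩
    obtain ⟨g, hg⟩ := hproj X (E k) (fun j hj => hX j hj.le) hk p hp (𝟙 _)
    rw [(hX k le_rfl).1 g] at hg
    haveI := (hE.1.1 k).2.2.1
    obtain ⟨x, hx⟩ := exists_ne (0 : E k)
    apply hx
    have := congrArg (fun t => t.hom x) hg
    simpa using this.symm
  · intro hno
    refine ⟨fun j hj => hE.1.2 k j hj, fun Y Z hY hZ p hp f => ?_⟩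
    by_contra hnl
    apply hno
    haveI hfin : ∀ j, Module.Finite A (E j) := fun j => (hE.1.1 j).1
    choose m q hq hqf hqp using fun j => exists_pres (K := K) hA (E j)
    haveI := hqf
    haveI := hqp
    have hp' : Function.Surjective p.hom := (ModuleCat.epi_iff_surjective p).1 hp
    let M : ModuleCat.{u} A := ModuleCat.of A (LinearMap.ker p.hom)
    let ι : M →ₗ[A] Y := (LinearMap.ker p.hom).subtype
    have hι : Function.Injective ι := (LinearMap.ker p.hom).injective_subtype
    have hιp : Function.Exact ι p.hom := LinearMap.exact_subtype_ker_map p.hom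
    -- perpendicularity in elementary terms
    let RP : Fin n → (N : Type u) → [AddCommGroup N] → [Module A N] → Prop :=
      fun j N _ _ => (∀ f : E j →ₗ[A] N, f = 0) ∧ EZ (q j) N
    have hRP : ∀ j (N : ModuleCat.{u} A), rperp (E j) N ↔ RP j N := fun j N =>
      and_congr (homZero_iff _ _) (extZero_iff_s4 _ _ (q j) (hq j))
    have hM : ∀ j, k < j → RP j M := by
      intro j hj
      have h1 := (hRP _ _).1 (hY j hj)
      have h2 := (hRP _ _).1 (hZ j hj)
      refine ⟨fun f => ?_, EZ.ker (q j) (hq j) ι p.hom hι hιp h2.1 h1.2⟩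
      ext1 x
      exact hι (by simpa using LinearMap.congr_fun (h1.1 (ι ∘ₗ f)) x)
    have hnM : ¬ EZ (q k) M := by
      intro h
      obtain ⟨g, hg⟩ := EZ.lift (q k) (hq k) ι p.hom hι hp' hιp h f.hom
      exact hnl ⟨ModuleCat.ofHom g, by ext x; exact hg x⟩
    have hEE : EZ (q k) (E k) := (extZero_iff_s4 _ _ (q k) (hq k)).1 (hE.1.1 k).2.1
    have hEk : ∀ j, k < j → RP j (E k) := fun j hj => (hRP _ _).1 (hE.1.2 k j hj)
    let I := LinearMap.ker (q k) →ₗ[A] M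
    obtain ⟨X, j, v, π, hj, hπ, hex, hv1, hqv1⟩ := univ_ext_s4 (q k) (hq k) M
    have hX : ∀ l, k < l → RP l X := by
      intro l hl
      refine ⟨hom_ext j π hj hex (hM l hl).1 (hom_finsupp (hEk l hl).1),
        EZ.ext (q l) j π hj hπ hex (EZ.finsupp (q l) (hEk l hl).2) fun f => ?_⟩
      obtain ⟨g, hg⟩ := (hM l hl).2 f
      exact ⟨j ∘ₗ g, fun x => by simp [hg]⟩
    have hXk : EZ (q k) X := EZ.ext (q k) j π hj hπ hex (EZ.finsupp (q k) hEE) fun f =>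
      ⟨v ∘ₗ Finsupp.lsingle f, fun x => hv1 f x⟩
    have hnM' : ∃ i : I, ¬ ∃ g : (Fin (m k) → A) →ₗ[A] M, ∀ x : LinearMap.ker (q k), g x = i x := by
      by_contra! hc
      exact hnM hc
    obtain ⟨i₀, hi₀⟩ := hnM'
    haveI := (hE.1.1 k).2.2.1
    obtain ⟨θ, hθ, hθ0⟩ := exists_theta (A := A) (E := E k) (X := X) (fun g hg => by
        have h1 : ModuleCat.ofHom g ≠ 0 := fun h => hg (by
          have := congrArg ModuleCat.Hom.hom h
          simpa using this)
        haveI := (hE.1.1 k).2.2.2 _ h1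
        exact (ConcreteCategory.bijective_of_isIso (ModuleCat.ofHom g))) π (Finsupp.lsingle i₀) (by
        rintro ⟨g, hg⟩
        apply hi₀
        obtain ⟨c, hc⟩ := fac_inj j hj (v ∘ₗ Finsupp.lsingle i₀ - g ∘ₗ q k) (fun x => (hex _).1 (by
          have := LinearMap.congr_fun hg (q k x)
          simp at this
          simp [hqv1, this]))
        refine ⟨c, fun x => hj ?_⟩
        have hx : q k x = 0 := x.2
        rw [hc, ← hv1]
        simp [hx])
    let τ := traceMap (A := A) (E k) X
    let T := LinearMap.range τ
    have hTm : ∀ (g : E k →ₗ[A] X) x, g x ∈ T := fun g x => ⟨Finsupp.single g x, by simp [τ, traceMap]⟩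
    have hTE : ∀ l, EZ (q l) (E k) → EZ (q l) T := fun l h =>
      EZ.quot (q l) (EZ.finsupp (q l) h) τ.rangeRestrict τ.surjective_rangeRestrict
    have hTex : Function.Exact T.subtype T.mkQ := LinearMap.exact_subtype_mkQ T
    have hlift : ∀ l, EZ (q l) (E k) → ∀ f : E l →ₗ[A] X ⧸ T, ∃ g : E l →ₗ[A] X, ∀ x, T.mkQ (g x) = f x :=
      fun l h f => EZ.lift (q l) (hq l) T.subtype T.mkQ T.injective_subtype T.mkQ_surjective hTex (hTE l h) f
    refine ⟨ModuleCat.of A (X ⧸ T), ModuleCat.ofHom (T.liftQ (θ ∘ₗ π) ?_), ?_, ?_⟩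
    · rintro _ ⟨z, rfl⟩
      have : (θ ∘ₗ π) ∘ₗ τ = 0 := by
        ext g x
        simpa [τ, traceMap] using LinearMap.congr_fun (hθ0 g) x
      exact LinearMap.congr_fun this z
    · intro l hl
      rw [hRP]
      rcases hl.lt_or_eq with hl | rfl
      · refine ⟨fun f => ?_, EZ.quot (q l) (hX l hl).2 T.mkQ T.mkQ_surjective⟩
        obtain ⟨g, hg⟩ := hlift l (hEk l hl).2 f
        ext1 x
        rw [← hg, (hX l hl).1 g]
        simp
      · refine ⟨fun f => ?_, EZ.quot (q k) hXk T.mkQ T.mkQ_surjective⟩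
        obtain ⟨g, hg⟩ := hlift k hEE f
        ext1 x
        rw [← hg]
        simpa using hTm g x
    · rw [ModuleCat.epi_iff_surjective]
      intro y
      obtain ⟨z, rfl⟩ := hθ y
      obtain ⟨x, rfl⟩ := hπ z
      exact ⟨T.mkQ x, by simp⟩

end ExcSeq
end

section
/- Let (E₁,…,Eₙ) be a complete exceptional sequence over a hereditary algebra Λ. Then Eₖ is relatively injective if and only if there is no monomorphism Eₖ ↪ Y with Y ∈ ℬ_{k+1} = ^⊥(E₁⊕⋯⊕Eₖ). -/
open CategoryTheory

universe u

variable {A : Type u} [Ring A]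

namespace ExcSeq

section Aux

open Limits Abelian

variable {X Y Z : ModuleCat.{u} A} {S : ShortComplex (ModuleCat.{u} A)}

/-- pushout of a short exact sequence -/
lemma pushout_shortExact (hS : S.ShortExact) (f : S.X₁ ⟶ Y) :
    (ShortComplex.mk (pushout.inr S.f f) (pushout.desc S.g (0 : Y ⟶ S.X₃) (by simp))
      (pushout.inr_desc _ _ _)).ShortExact := by
  have := hS.mono_f
  have := hS.epi_g
  have hepi : Epi (pushout.desc S.g (0 : Y ⟶ S.X₃) (by simp) : pushout S.f f ⟶ S.X₃) := by
    have : Epi (pushout.inl S.f f ≫ pushout.desc S.g (0 : Y ⟶ S.X₃) (by simp)) := by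
      rw [pushout.inl_desc]; infer_instance
    exact epi_of_epi (pushout.inl S.f f) _
  have hmono : Mono (pushout.inr S.f f) := inferInstance
  refine ⟨?_⟩
  apply ShortComplex.exact_of_g_is_cokernel
  refine CokernelCofork.IsColimit.ofπ' _ _ (fun {T} k hk => ?_)
  have h1 : S.f ≫ (pushout.inl S.f f ≫ k) = 0 := by
    rw [← Category.assoc, pushout.condition, Category.assoc]
    dsimp at hk
    rw [hk, comp_zero]
  refine ⟨hS.gIsCokernel.desc (CokernelCofork.ofπ _ h1), ?_⟩
  have h2 := hS.gIsCokernel.fac (CokernelCofork.ofπ _ h1) WalkingParallelPair.one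
  dsimp at h2 hk ⊢
  apply pushout.hom_ext
  · rw [pushout.inl_desc_assoc]; exact h2
  · rw [pushout.inr_desc_assoc, zero_comp, hk]

lemma ext_extend (hS : S.ShortExact) (h : extZero S.X₃ Y) (f : S.X₁ ⟶ Y) :
    ∃ g : S.X₂ ⟶ Y, S.f ≫ g = f := by
  obtain ⟨s, hs⟩ := h _ _ _ _ (pushout_shortExact hS f)
  have hT := pushout_shortExact hS f
  let sp := ShortComplex.Splitting.ofExactOfSection _ hT.exact s hs hT.mono_f
  refine ⟨pushout.inl S.f f ≫ sp.r, ?_⟩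
  rw [← Category.assoc, pushout.condition, Category.assoc]
  have := sp.f_r
  dsimp at this
  rw [this, Category.comp_id]

lemma extZero_iff_s5 : extZero X Y ↔ ∀ x : Ext X Y 1, x = 0 := by
  constructor
  · intro h x
    have hS := X.shortExact_projectiveShortComplex
    have : Projective X.projectiveShortComplex.X₂ := by
      refine ModuleCat.projective_of_free (Module.Free.chooseBasis A X.projectiveShortComplex.X₂)
    obtain ⟨y, rfl⟩ := precomp_extClass_surjective_of_projective_X₂ Y hS 0 x
    obtain ⟨f, rfl⟩ := (Ext.mk₀_bijective _ _).2 y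
    obtain ⟨g, rfl⟩ := ext_extend hS h f
    rw [← Ext.mk₀_comp_mk₀]
    exact hS.extClass_comp_assoc (Ext.mk₀ g) (h := add_zero 1)
  · intro h E i p w hS
    obtain ⟨y, hy⟩ := Ext.covariant_sequence_exact₃ X hS (Ext.mk₀ (𝟙 X)) (zero_add 1) (h _)
    obtain ⟨f, rfl⟩ := (Ext.mk₀_bijective _ _).2 y
    refine ⟨f, ?_⟩
    rw [Ext.mk₀_comp_mk₀] at hy
    exact (Ext.mk₀_bijective _ _).1 hy

lemma homZero_iff_s5 : homZero X Y ↔ ∀ x : Ext X Y 0, x = 0 := by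
  constructor
  · intro h x
    obtain ⟨f, rfl⟩ := (Ext.mk₀_bijective _ _).2 x
    rw [h f, Ext.mk₀_zero]
  · intro h f
    apply (Ext.mk₀_bijective _ _).1
    rw [h (Ext.mk₀ f), Ext.mk₀_zero]

lemma ext_mid (hS : S.ShortExact) (h1 : extZero S.X₁ Y) (h3 : extZero S.X₃ Y) :
    extZero S.X₂ Y := by
  rw [extZero_iff_s5] at *
  intro x
  obtain ⟨y, rfl⟩ := Ext.contravariant_sequence_exact₂ hS Y x (h1 _)
  rw [h3 y, Ext.comp_zero]

lemma ext_right (hS : S.ShortExact) (h1 : homZero S.X₁ Y) (h2 : extZero S.X₂ Y) :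
    extZero S.X₃ Y := by
  rw [extZero_iff_s5] at *
  rw [homZero_iff_s5] at h1
  intro x
  obtain ⟨y, rfl⟩ := Ext.contravariant_sequence_exact₃ hS Y x (h2 _) (add_zero 1)
  rw [h1 y, Ext.comp_zero]

lemma pd_le (hA : Hereditary A) (X : ModuleCat.{u} A) : HasProjectiveDimensionLT X 2 := by
  have hS := X.shortExact_projectiveShortComplex
  have h2 : Projective X.projectiveShortComplex.X₂ :=
    ModuleCat.projective_of_free (Module.Free.chooseBasis A X.projectiveShortComplex.X₂)
  have h1 : Projective X.projectiveShortComplex.X₁ := hA _ h2 _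
  exact hS.hasProjectiveDimensionLT_X₃ 1 inferInstance inferInstance

lemma ext_sub (hA : Hereditary A) (hS : S.ShortExact) (h2 : extZero S.X₂ Y) :
    extZero S.X₁ Y := by
  rw [extZero_iff_s5] at *
  intro x
  have := pd_le hA S.X₃
  obtain ⟨y, rfl⟩ := Ext.contravariant_sequence_exact₁ hS Y x (n₁ := 2) rfl
    (Ext.eq_zero_of_hasProjectiveDimensionLT _ 2 le_rfl)
  rw [h2 y, Ext.comp_zero]

lemma hom_left (hS : S.ShortExact) (h2 : homZero S.X₂ Y) (h3 : extZero S.X₃ Y) :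
    homZero S.X₁ Y := by
  intro f
  obtain ⟨g, rfl⟩ := ext_extend hS h3 f
  rw [h2 g, comp_zero]

lemma hom_right (p : X ⟶ Z) [Epi p] (h2 : homZero X Y) : homZero Z Y := by
  intro f
  rw [← cancel_epi p, h2 (p ≫ f), comp_zero]

lemma hom_mid (hS : S.ShortExact) (h1 : homZero S.X₁ Y) (h3 : homZero S.X₃ Y) :
    homZero S.X₂ Y := by
  rw [homZero_iff_s5] at *
  intro x
  obtain ⟨y, rfl⟩ := Ext.contravariant_sequence_exact₂ hS Y x (h1 _)
  rw [h3 y, Ext.comp_zero]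

lemma ext_mid' (hS : S.ShortExact) (h1 : extZero Y S.X₁) (h3 : extZero Y S.X₃) :
    extZero Y S.X₂ := by
  rw [extZero_iff_s5] at *
  intro x
  obtain ⟨y, rfl⟩ := Ext.covariant_sequence_exact₂ Y hS x (h3 _)
  rw [h1 y, Ext.zero_comp]

lemma ext_left' (hS : S.ShortExact) (h1 : homZero Y S.X₃) (h2 : extZero Y S.X₂) :
    extZero Y S.X₁ := by
  rw [extZero_iff_s5] at *
  rw [homZero_iff_s5] at h1
  intro x
  obtain ⟨y, rfl⟩ := Ext.covariant_sequence_exact₁ Y hS x (h2 _) (zero_add 1)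
  rw [h1 y, Ext.zero_comp]

lemma ext_lift (hS : S.ShortExact) (h1 : extZero Y S.X₁) (f : Y ⟶ S.X₃) :
    ∃ g : Y ⟶ S.X₂, g ≫ S.g = f := by
  rw [extZero_iff_s5] at h1
  obtain ⟨y, hy⟩ := Ext.covariant_sequence_exact₃ Y hS (Ext.mk₀ f) (zero_add 1) (h1 _)
  obtain ⟨g, rfl⟩ := (Ext.mk₀_bijective _ _).2 y
  refine ⟨g, ?_⟩
  rw [Ext.mk₀_comp_mk₀] at hy
  exact (Ext.mk₀_bijective _ _).1 hy

lemma ext_retract {Q E : ModuleCat.{u} A} (i : E ⟶ Q) (r : Q ⟶ E) (h : i ≫ r = 𝟙 E)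
    (hQ : extZero Y Q) : extZero Y E := by
  rw [extZero_iff_s5] at *
  intro x
  have h1 : (x.comp (Ext.mk₀ i) (add_zero 1)).comp (Ext.mk₀ r) (add_zero 1) = x := by
    rw [Ext.comp_assoc_of_third_deg_zero, Ext.mk₀_comp_mk₀, h, Ext.comp_mk₀_id]
  rw [← h1, hQ (x.comp (Ext.mk₀ i) (add_zero 1)), Ext.zero_comp]

end Aux
section Aux2

open Limits Abelian

variable {X Y Z : ModuleCat.{u} A} {S : ShortComplex (ModuleCat.{u} A)}

lemma coker_shortExact (i : X ⟶ Z) [Mono i] :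
    (ShortComplex.mk i (cokernel.π i) (cokernel.condition i)).ShortExact :=
  { exact := ShortComplex.exact_cokernel i }

lemma ext_mono (hA : Hereditary A) (i : X ⟶ Z) [Mono i] (h : extZero Z Y) : extZero X Y :=
  ext_sub hA (coker_shortExact i) h

lemma hom_mono (i : X ⟶ Z) [Mono i] (h : homZero Y Z) : homZero Y X := by
  intro f
  rw [← cancel_mono i, h (f ≫ i), zero_comp]

lemma finite_mid [IsNoetherianRing A] (hS : S.ShortExact) (h1 : Module.Finite A S.X₁)
    (h3 : Module.Finite A S.X₃) : Module.Finite A S.X₂ := by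
  have := isNoetherian_of_range_eq_ker S.f.hom S.g.hom hS.exact.moduleCat_range_eq_ker
  infer_instance

/-- `V` behaves like the coreflection of `W` to `^⊥E`. -/
def Corefl (E W V : ModuleCat.{u} A) : Prop :=
  ∃ p : V ⟶ W, (∀ Y, lperp E Y → (∀ f : Y ⟶ W, ∃ g : Y ⟶ V, g ≫ p = f) ∧
    (extZero Y W → extZero Y V)) ∧ (∀ F, lperp F E → lperp F W → lperp F V)

lemma Corefl.refl (E W : ModuleCat.{u} A) : Corefl E W W :=
  ⟨𝟙 W, fun _ _ => ⟨fun f => ⟨f, Category.comp_id f⟩, id⟩, fun _ _ h => h⟩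

lemma Corefl.trans {E W V U : ModuleCat.{u} A} (h : Corefl E W V) (h' : Corefl E V U) :
    Corefl E W U := by
  obtain ⟨p, h1, h2⟩ := h
  obtain ⟨q, h1', h2'⟩ := h'
  refine ⟨q ≫ p, fun Y hY => ⟨fun f => ?_, fun h => (h1' Y hY).2 ((h1 Y hY).2 h)⟩,
    fun F hF hW => h2' F hF (h2 F hF hW)⟩
  obtain ⟨g, rfl⟩ := (h1 Y hY).1 f
  obtain ⟨g', rfl⟩ := (h1' Y hY).1 g
  exact ⟨g', by simp⟩

lemma phase1 [IsNoetherianRing A] [IsArtinianRing A] (hA : Hereditary A)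
    {E : ModuleCat.{u} A} (hE : extZero E E) (d : ℕ∞) :
    ∀ W : ModuleCat.{u} A, Module.Finite A W → Module.length A W = d →
    ∃ V : ModuleCat.{u} A, Module.Finite A V ∧ Corefl E W V ∧ homZero V E ∧
      (extZero V E → extZero W E) := by
  induction d using WellFoundedLT.induction with
  | ind d ih =>
  intro W hW hd
  by_cases h0 : homZero W E
  · exact ⟨W, hW, Corefl.refl E W, h0, id⟩
  unfold homZero at h0
  push Not at h0
  obtain ⟨f, hf⟩ := h0
  have hS := LinearMap.shortExact_shortComplexKer f.hom.surjective_rangeRestrict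
  let R : ModuleCat.{u} A := ModuleCat.of A (LinearMap.range f.hom)
  let N : ModuleCat.{u} A := ModuleCat.of A (LinearMap.ker f.hom.rangeRestrict)
  let i : R ⟶ E := ModuleCat.ofHom (LinearMap.range f.hom).subtype
  have hi : Mono i := (ModuleCat.mono_iff_injective _).mpr (Submodule.injective_subtype _)
  have hR : ∀ F, extZero E F → extZero R F := fun F h => ext_mono hA i h
  have hN : Module.Finite A N := inferInstanceAs (Module.Finite A (LinearMap.ker f.hom.rangeRestrict))
  have hlt : Module.length A N < d := by
    rw [← hd]
    apply Submodule.length_lt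
    intro h
    apply hf
    ext x
    have : x ∈ LinearMap.ker f.hom.rangeRestrict := h ▸ Submodule.mem_top
    rw [LinearMap.ker_rangeRestrict] at this
    simpa using this
  obtain ⟨V, hV, hc, h1, h2⟩ := ih _ hlt N hN rfl
  refine ⟨V, hV, Corefl.trans ?_ hc, h1, fun h => ext_mid hS (h2 h) (hR E hE)⟩
  refine ⟨LinearMap.shortComplexKer _ |>.f, fun Y hY => ⟨fun g => ?_, fun h => ?_⟩,
    fun F hF hWF => ⟨?_, ?_⟩⟩
  · have h3 : homZero Y R := hom_mono i hY.1
    exact ⟨hS.fIsKernel.lift (KernelFork.ofι g (h3 _)),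
      hS.fIsKernel.fac (KernelFork.ofι g (h3 _)) WalkingParallelPair.zero⟩
  · exact ext_left' hS (hom_mono i hY.1) h
  · exact hom_left hS hWF.1 (hR F hF.2)
  · exact ext_sub hA hS hWF.2

open ModuleCat in
lemma finite_ext {K : Type u} [Field K] {A : Type u} [Ring A] [Algebra K A]
    [FiniteDimensional K A] (W E : ModuleCat.{u} A) (hW : Module.Finite A W)
    (hE : Module.Finite A E) : Module.Finite K (Ext W E 1) := by
  have : IsNoetherianRing A := IsNoetherianRing.of_finite K A
  obtain ⟨n, f, hf⟩ := Module.Finite.exists_fin' A W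
  let g : (ULift.{u} (Fin n) → A) →ₗ[A] W := f ∘ₗ (LinearMap.funLeft A A ULift.up)
  have hg : Function.Surjective g := hf.comp
    (LinearMap.funLeft_surjective_of_injective _ _ _ ULift.up_injective)
  have hS := LinearMap.shortExact_shortComplexKer hg
  have : Projective g.shortComplexKer.X₂ :=
    ModuleCat.projective_of_free (Module.Free.chooseBasis A (ULift.{u} (Fin n) → A))
  have hfin : ∀ P : ModuleCat.{u} A, Module.Finite A P → Module.Finite K (Ext P E 0) := by
    intro P hP
    have h1 : Module.Finite K P := Module.Finite.trans A P
    have h2 : Module.Finite K E := Module.Finite.trans A E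
    let φ : (P ⟶ E) →ₗ[K] (P →ₗ[K] E) :=
      { toFun := fun f => f.hom.restrictScalars K
        map_add' := fun _ _ => rfl
        map_smul' := fun _ _ => rfl }
    have h3 : Module.Finite K (P ⟶ E) := Module.Finite.of_injective φ (by
      intro a b h
      ext x
      exact LinearMap.congr_fun h x)
    exact Module.Finite.equiv (Ext.linearEquiv₀ (R := K)).symm
  have := hfin g.shortComplexKer.X₁ (inferInstanceAs (Module.Finite A (LinearMap.ker g)))
  exact Module.Finite.of_surjective (hS.extClass.precompOfLinear K E (add_comm 1 0))
      (precomp_extClass_surjective_of_projective_X₂ E hS 0)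

lemma phase2 {K : Type u} [Field K] {A : Type u} [Ring A] [Algebra K A]
    [FiniteDimensional K A] {E : ModuleCat.{u} A} (hE : ExceptionalMod E) (d : ℕ) :
    ∀ W : ModuleCat.{u} A, Module.Finite A W → homZero W E →
      Module.finrank K (Ext W E 1) = d →
    ∃ V : ModuleCat.{u} A, Module.Finite A V ∧ Corefl E W V ∧ lperp E V ∧
      (extZero W E ∨ ∃ i : E ⟶ V, Mono i) := by
  have : IsNoetherianRing A := IsNoetherianRing.of_finite K A
  induction d using Nat.strong_induction_on with
  | h d ih =>
  intro W hW h0 hd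
  by_cases h1 : extZero W E
  · exact ⟨W, hW, Corefl.refl E W, ⟨h0, h1⟩, Or.inl h1⟩
  have h1' := h1
  unfold extZero at h1
  push Not at h1
  obtain ⟨P, i, p, w, hS, hns⟩ := h1
  have hmono : Mono i := hS.mono_f
  have hP : Module.Finite A P := finite_mid hS hE.1 hW
  have hP0 : homZero P E := by
    intro f
    by_cases hif : i ≫ f = 0
    · obtain ⟨g, hg⟩ : ∃ g : W ⟶ E, p ≫ g = f :=
        ⟨hS.gIsCokernel.desc (CokernelCofork.ofπ f hif),
          hS.gIsCokernel.fac (CokernelCofork.ofπ f hif) WalkingParallelPair.one⟩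
      rw [← hg, h0 g, comp_zero]
    · exfalso
      have := hE.2.2.2 _ hif
      let sp := ShortComplex.Splitting.ofExactOfRetraction _ hS.exact (f ≫ inv (i ≫ f))
        (by simp [← Category.assoc]) hS.epi_g
      exact hns sp.s sp.s_g
  have hc : Corefl E W P := by
    refine ⟨p, fun Y hY => ⟨fun g => ?_, fun h => ?_⟩, fun F hF hWF => ⟨?_, ?_⟩⟩
    · exact ext_lift hS hY.2 g
    · exact ext_mid' hS hY.2 h
    · exact hom_mid hS hF.1 hWF.1
    · exact ext_mid hS hF.2 hWF.2
  by_cases h2 : extZero P E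
  · exact ⟨P, hP, hc, ⟨hP0, h2⟩, Or.inr ⟨i, hmono⟩⟩
  have hlt : Module.finrank K (Ext P E 1) < d := by
    have := finite_ext (K := K) W E hW hE.1
    let φ : Ext W E 1 →ₗ[K] Ext P E 1 := (Ext.mk₀ p).precompOfLinear K E (zero_add 1)
    have hφ : Function.Surjective φ := by
      intro x
      obtain ⟨y, hy⟩ := Ext.contravariant_sequence_exact₂ hS E x (extZero_iff_s5.1 hE.2.1 _)
      exact ⟨y, hy⟩
    have hk : φ hS.extClass = 0 := hS.comp_extClass
    have hne : hS.extClass ≠ 0 := by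
      intro h
      obtain ⟨y, hy⟩ := Ext.covariant_sequence_exact₃ W hS (Ext.mk₀ (𝟙 W)) (zero_add 1)
        (by rw [h, Ext.comp_zero])
      obtain ⟨f, rfl⟩ := (Ext.mk₀_bijective _ _).2 y
      rw [Ext.mk₀_comp_mk₀] at hy
      exact hns f ((Ext.mk₀_bijective _ _).1 hy)
    have h3 := LinearMap.finrank_range_add_finrank_ker φ
    rw [LinearMap.range_eq_top.2 hφ, finrank_top] at h3
    have h4 : 0 < Module.finrank K (LinearMap.ker φ) := by
      rw [Module.finrank_pos_iff_exists_ne_zero]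
      exact ⟨⟨hS.extClass, hk⟩, fun h => hne (congrArg Subtype.val h)⟩
    omega
  obtain ⟨V, hV, hc', hV', h | h⟩ := ih _ hlt P hP hP0 rfl
  · exact absurd h h2
  · exact ⟨V, hV, hc.trans hc', hV', Or.inr h⟩

lemma step {K : Type u} [Field K] {A : Type u} [Ring A] [Algebra K A]
    [FiniteDimensional K A] (hA : Hereditary A) {E : ModuleCat.{u} A} (hE : ExceptionalMod E)
    (W : ModuleCat.{u} A) (hW : Module.Finite A W) :
    ∃ V : ModuleCat.{u} A, Module.Finite A V ∧ Corefl E W V ∧ lperp E V ∧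
      (extZero W E ∨ ∃ i : E ⟶ V, Mono i) := by
  have : IsNoetherianRing A := IsNoetherianRing.of_finite K A
  have : IsArtinianRing A := IsArtinianRing.of_finite K A
  obtain ⟨U, hU, hc, h0, h1⟩ := phase1 hA hE.2.1 _ W hW rfl
  obtain ⟨V, hV, hc', hV', h⟩ := phase2 (K := K) hE _ U hU h0 rfl
  exact ⟨V, hV, hc.trans hc', hV', h.imp_left h1⟩

open ModuleCat in
/-- finite injective cogenerator of the whole module category -/
lemma base (K : Type u) [Field K] (A : Type u) [Ring A] [Algebra K A]
    [FiniteDimensional K A] :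
    ∃ J : ModuleCat.{u} A, Module.Finite A J ∧ ∀ Y : ModuleCat.{u} A, extZero Y J ∧
      ∀ y : Y, y ≠ 0 → ∃ f : Y ⟶ J, f y ≠ 0 := by
  let J : ModuleCat.{u} A := (ModuleCat.coextendScalars (algebraMap K A)).obj (ModuleCat.of K K)
  have hinj : Injective J := by
    have : Injective (ModuleCat.of K K) := by
      refine ⟨fun {X Y} g f hf => ?_⟩
      obtain ⟨r, hr⟩ := LinearMap.exists_leftInverse_of_injective f.hom
        (LinearMap.ker_eq_bot.2 ((ModuleCat.mono_iff_injective f).1 hf))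
      refine ⟨ModuleCat.ofHom (g.hom ∘ₗ r), ?_⟩
      ext x
      have := LinearMap.congr_fun hr x
      simp at this
      simp [this]
    exact Injective.injective_of_adjoint
      (ModuleCat.restrictCoextendScalarsAdj (algebraMap K A)) _
  refine ⟨J, ?_, fun Y => ⟨?_, fun y hy => ?_⟩⟩
  · let φ : (A →ₗ[K] K) →ₗ[K] J :=
      { toFun := fun g => (CoextendScalars.equiv (algebraMap K A) (ModuleCat.of K K)).symm
          { toFun := fun a : A => g a
            map_add' := fun a b => g.map_add a b
            map_smul' := fun c a => by
              have h : ((c • a : (ModuleCat.restrictScalars (algebraMap K A)).obj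
                (ModuleCat.of A A)) : A) = c • (show A from a) := by
                rw [Algebra.smul_def]; rfl
              exact (congrArg g h).trans (g.map_smul c _) }
        map_add' := fun a b => rfl
        map_smul' := fun c g => by
          apply CoextendScalars.ext
          apply LinearMap.ext
          intro (a : A)
          change c • g a = g (a * algebraMap K A c)
          rw [← Algebra.commutes, ← Algebra.smul_def, map_smul] }
    have hφ : Function.Surjective φ := by
      intro g
      let e := CoextendScalars.equiv (algebraMap K A) (ModuleCat.of K K) g
      refine ⟨{ toFun := fun a => e a
                map_add' := fun a b => e.map_add a b
                map_smul' := fun c a => ?_ }, rfl⟩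
      refine Eq.trans ?_ (e.map_smul c a)
      rw [Algebra.smul_def]
      rfl
    have : Module.Finite K J := Module.Finite.of_surjective φ hφ
    exact Module.Finite.of_restrictScalars_finite K A J
  · rw [extZero_iff_s5]
    exact fun x => Ext.eq_zero_of_injective x
  · let Y' := (ModuleCat.restrictScalars (algebraMap K A)).obj Y
    obtain ⟨g, hg⟩ : ∃ g : Y' →ₗ[K] K, g y ≠ 0 := by
      by_contra! h
      exact hy ((Module.forall_dual_apply_eq_zero_iff K (show Y' from y)).1 h)
    refine ⟨RestrictionCoextensionAdj.HomEquiv.fromRestriction (algebraMap K A)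
      (X := ModuleCat.of K K) (ModuleCat.ofHom g), fun h => hg ?_⟩
    have h1 := congrArg (fun z : J => (CoextendScalars.equiv (algebraMap K A) (ModuleCat.of K K) z) (1 : A)) h
    change g ((1 : A) • y) = 0 at h1
    rwa [one_smul] at h1

end Aux2
section Aux3

open Limits Abelian

/-- `Q` is built from `J`. -/
def Built (J Q : ModuleCat.{u} A) : Prop :=
  (∀ F, homZero J F → homZero Q F) ∧ (∀ F, extZero J F → extZero Q F) ∧
    (∀ Y, extZero Y J → extZero Y Q) ∧ (Module.Finite A J → Module.Finite A Q)

lemma prod_shortExact (Q J : ModuleCat.{u} A) :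
    (ModuleCat.shortComplexOfCompEqZero (LinearMap.inl A Q J) (LinearMap.snd A Q J)
      (by ext; simp)).ShortExact where
  exact := (ShortComplex.ShortExact.moduleCat_exact_iff_function_exact _).mpr
    Function.Exact.inl_snd
  mono_f := (ModuleCat.mono_iff_injective _).mpr LinearMap.inl_injective
  epi_g := (ModuleCat.epi_iff_surjective _).mpr LinearMap.snd_surjective

lemma Built.prod {J Q : ModuleCat.{u} A} (h : Built J Q) :
    Built J (ModuleCat.of A (Q × J)) :=
  have hS := prod_shortExact Q J
  ⟨fun F hF => hom_mid hS (h.1 F hF) hF, fun F hF => ext_mid hS (h.2.1 F hF) hF,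
    fun Y hY => ext_mid' hS (h.2.2.1 Y hY) hY, fun hJ =>
      have := h.2.2.2 hJ
      inferInstanceAs (Module.Finite A (Q × J))⟩

lemma Built.refl (J : ModuleCat.{u} A) : Built J J := ⟨fun _ => id, fun _ => id, fun _ => id, id⟩

lemma embed [IsArtinianRing A] {J C : ModuleCat.{u} A} (hC : Module.Finite A C)
    (hJ : ∀ y : C, y ≠ 0 → ∃ f : C ⟶ J, f y ≠ 0) :
    ∃ (Q : ModuleCat.{u} A) (i : C ⟶ Q), Built J Q ∧ Mono i := by
  let T : Set (Submodule A C) := {N | ∃ (Q : ModuleCat.{u} A) (i : C ⟶ Q), Built J Q ∧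
    LinearMap.ker i.hom = N}
  have hT : T.Nonempty := ⟨_, J, 0, Built.refl J, rfl⟩
  obtain ⟨N, ⟨Q, i, hQ, hN⟩, hmin⟩ := WellFounded.has_min
    (wellFounded_lt : WellFounded (· < · : Submodule A C → _ → Prop)) T hT
  refine ⟨Q, i, hQ, ?_⟩
  rw [ModuleCat.mono_iff_ker_eq_bot, eq_bot_iff]
  intro y hy
  by_contra h0
  obtain ⟨f, hf⟩ := hJ y h0
  refine hmin _ ⟨_, ModuleCat.ofHom (i.hom.prod f.hom), hQ.prod, rfl⟩ ?_
  rw [← hN]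
  refine lt_of_le_of_ne ?_ ?_
  · intro z hz
    simp at hz ⊢
    exact hz.1
  · intro h
    rw [← h] at hy
    simp at hy
    exact hf hy.2

lemma tower {K : Type u} [Field K] {A : Type u} [Ring A] [Algebra K A]
    [FiniteDimensional K A] (hA : Hereditary A)
    {n : ℕ} (E : Fin n → ModuleCat.{u} A) (hE : IsExcSeq E) (k : ℕ) (hk : k ≤ n) :
    ∃ J : ModuleCat.{u} A, Module.Finite A J ∧ (∀ j : Fin n, j.val < k → lperp (E j) J) ∧
      ∀ Y : ModuleCat.{u} A, (∀ j : Fin n, j.val < k → lperp (E j) Y) → extZero Y J ∧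
      ∀ y : Y, y ≠ 0 → ∃ f : Y ⟶ J, f y ≠ 0 := by
  induction k with
  | zero =>
    obtain ⟨J, h1, h2⟩ := base K A
    exact ⟨J, h1, fun j hj => absurd hj (Nat.not_lt_zero _), fun Y _ => h2 Y⟩
  | succ k ih =>
    obtain ⟨J, h1, h2, h3⟩ := ih (by omega)
    let k' : Fin n := ⟨k, hk⟩
    obtain ⟨V, hV, ⟨p, hp, hF⟩, hVE, -⟩ := step (K := K) hA (hE.1 k') J h1
    refine ⟨V, hV, fun j hj => ?_, fun Y hY => ?_⟩
    · rcases Nat.lt_succ_iff_lt_or_eq.1 hj with h | h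
      · exact hF (E j) (hE.2 j k' h) (h2 j h)
      · have : j = k' := Fin.ext h
        rw [this]; exact hVE
    · obtain ⟨h4, h5⟩ := h3 Y (fun j hj => hY j (by omega))
      have hYk := hY k' (Nat.lt_succ_self k)
      refine ⟨(hp Y hYk).2 h4, fun y hy => ?_⟩
      obtain ⟨f, hf⟩ := h5 y hy
      obtain ⟨g, rfl⟩ := (hp Y hYk).1 f
      refine ⟨g, fun h => hf ?_⟩
      simp [h]

end Aux3

/-- `Eₖ` is relatively injective if and only if there is no monomorphism
`Eₖ ↪ Y` with `Y ∈ ℬ_{k+1} = ^⊥(E₁ ⊕ ⋯ ⊕ Eₖ)`. -/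
theorem stmt5 {K : Type u} [Field K] {A : Type u} [Ring A] [Algebra K A]
    [FiniteDimensional K A] (hA : Hereditary A)
    {n : ℕ} (E : Fin n → ModuleCat.{u} A) (hE : CompleteES E) (k : Fin n) :
    RelInj E k ↔
      ¬ ∃ (Y : ModuleCat.{u} A) (i : E k ⟶ Y),
          (∀ j : Fin n, j ≤ k → lperp (E j) Y) ∧ Mono i := by
  have : IsNoetherianRing A := IsNoetherianRing.of_finite K A
  have : IsArtinianRing A := IsArtinianRing.of_finite K A
  have hX := hE.1
  have hEk := hX.1 k
  have hEB : Bperp E k (E k) := fun j hj => hX.2 j k hj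
  constructor
  · rintro ⟨-, h⟩ ⟨Y, i, hY, hi⟩
    obtain ⟨g, hg⟩ := h (E k) Y hEB (fun j hj => hY j hj.le) i hi (𝟙 _)
    rw [(hY k le_rfl).1 g, Limits.comp_zero] at hg
    have := hEk.2.2.1
    obtain ⟨x, hx⟩ := exists_ne (0 : E k)
    apply hx
    have h2 := congrArg (fun f : E k ⟶ E k => f x) hg
    simpa using h2.symm
  · intro hno
    have cok : ∀ {S : ShortComplex (ModuleCat.{u} A)}, S.ShortExact → Bperp E k S.X₁ →
        Bperp E k S.X₂ → Bperp E k S.X₃ := by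
      intro S hS h1 h2 j hj
      have := hS.epi_g
      exact ⟨hom_right S.g (h2 j hj).1, ext_right hS (h1 j hj).1 (h2 j hj).2⟩
    obtain ⟨J, hJ, hJB, hJ'⟩ := tower (K := K) hA E hX k.val k.isLt.le
    obtain ⟨V, hV, ⟨p, hp, hF⟩, hVE, h⟩ := step (K := K) hA hEk J hJ
    have hJE : extZero J (E k) := by
      rcases h with h | ⟨i, hi⟩
      · exact h
      · exfalso
        refine hno ⟨V, i, fun j hj => ?_, hi⟩
        rcases lt_or_eq_of_le hj with h | h
        · exact hF (E j) (hX.2 j k h) (hJB j h)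
        · rw [h]; exact hVE
    have hEfin := hEk.1
    obtain ⟨Q, i, hQ, hi⟩ := embed hEfin (hJ' (E k) hEB).2
    have hQfin := hQ.2.2.2 hJ
    have hQB : Bperp E k Q := fun j hj => ⟨hQ.1 _ (hJB j hj).1, hQ.2.1 _ (hJB j hj).2⟩
    have hS := coker_shortExact i
    have hCB := cok hS hEB hQB
    have hCfin : Module.Finite A (Limits.cokernel i : ModuleCat.{u} A) :=
      Module.Finite.of_surjective (Limits.cokernel.π i).hom
        ((ModuleCat.epi_iff_surjective _).1 inferInstance)
    obtain ⟨Q', i', hQ', hi'⟩ := embed hCfin (hJ' _ hCB).2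
    have hCE : extZero (Limits.cokernel i) (E k) := ext_mono hA i' (hQ'.2.1 _ hJE)
    obtain ⟨r, hr⟩ := ext_extend hS hCE (𝟙 (E k))
    refine ⟨hEB, fun Y Z hY hZ m hm f => ?_⟩
    have hS' := coker_shortExact m
    have hW := cok hS' hY hZ
    exact ext_extend hS' (ext_retract i r hr (hQ.2.2.1 _ (hJ' _ hW).1)) f

end ExcSeq
end
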